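/- arXiv:math/0208107 — 3 statements merged into one kernel-verified Lean document; each statement's English description precedes it below -/
import Mathlib

section
/- Let W be an n-dimensional vector space. There exists a nonempty open subset U of Fl(W)^s, depending only on W, with the following property: for every 𝓔 ∈ U and every pair of subspaces S ⊆ V ⊆ W with dim(V)=r and dim(S)=d, letting 𝓘=(I^1,…,I^s) be the unique s-tuple of subsets of [n] of cardinality r with V ∈ ∩_j Ω°_{I^j}(E^j_•) and 𝓚=(K^1,…,K^s) the unique s-tuple of subsets of [r] of cardinality d with S ∈ ∩_j Ω°_{K^j}(E^j_•(V)), one has dim(S,V,𝓔(V)) − dim(S,W,𝓔) ≤ 0, and consequently Σ_{j=1}^{s} Σ_{a∈K^j}(n−r+a−i^j_a) − d(n−r) ≤ 0. -/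
noncomputable section

open Module Submodule

/-! ### Polynomial functions and the Zariski topology on a vector space -/

/-- Evaluation of a polynomial in linear functionals at a point of a vector space.
These are exactly the polynomial functions on a finite-dimensional vector space. -/
def mEval (k : Type*) {M : Type*} [Field k] [AddCommGroup M] [Module k M]
    (x : M) (p : MvPolynomial (Module.Dual k M) k) : k :=
  MvPolynomial.eval (fun l : Module.Dual k M => l x) p

/-- The Zariski topology on a (finite-dimensional) vector space, generated by the
complements of zero sets of polynomial functions. -/
def mZariski (k M : Type*) [Field k] [AddCommGroup M] [Module k M] :
    TopologicalSpace M :=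
  TopologicalSpace.generateFrom
    {U : Set M | ∃ p : MvPolynomial (Module.Dual k M) k, U = {x : M | mEval k x p ≠ 0}}

/-- The Zariski tangent space at a point `x` to a subset `A` of a vector space:
the common kernel of the differentials at `x` of all polynomial functions vanishing on `A`. -/
def mTangent (k : Type*) {M : Type*} [Field k] [AddCommGroup M] [Module k M]
    (A : Set M) (x : M) : Submodule k M :=
  letI := Classical.decEq (Module.Dual k M)
  ⨅ p ∈ {p : MvPolynomial (Module.Dual k M) k | ∀ a ∈ A, mEval k a p = 0},
    LinearMap.ker (∑ l ∈ p.vars, mEval k x (MvPolynomial.pderiv l p) • (l : Module.Dual k M))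

/-- `f : M → N` is a polynomial map on a subset `A ⊆ M`. -/
def IsPolyOn (k : Type*) {M N : Type*} [Field k] [AddCommGroup M] [Module k M]
    [AddCommGroup N] [Module k N] (A : Set M) (f : M → N) : Prop :=
  ∀ l : Module.Dual k N, ∃ p : MvPolynomial (Module.Dual k M) k, ∀ x ∈ A, l (f x) = mEval k x p

/-- Dimension (topological Krull dimension) of a subset of a topological space. -/
def subDim {α : Type*} (t : TopologicalSpace α) (C : Set α) : WithBot ℕ∞ :=
  @topologicalKrullDim C (TopologicalSpace.induced (Subtype.val : C → α) t)

/-- The irreducible components of a subset `A` of a topological space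
(for the subspace topology). -/
def subComponents {α : Type*} (t : TopologicalSpace α) (A : Set α) : Set (Set ↥A) :=
  @irreducibleComponents A (TopologicalSpace.induced (Subtype.val : A → α) t)

/-- Dimension of a subset `C` of a subspace `A` of a topological space. -/
def compDim {α : Type*} (t : TopologicalSpace α) (A : Set α) (C : Set ↥A) : WithBot ℕ∞ :=
  subDim (TopologicalSpace.induced (Subtype.val : A → α) t) C

/-! ### Flags, Schubert cells and Schubert varieties -/

/-- A complete flag on a finite-dimensional vector space, recorded as the increasing
function sending `m` to the `m`-th member (of dimension `m`) of the flag. -/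
def IsFlag {k M : Type*} [Field k] [AddCommGroup M] [Module k M]
    (E : ℕ → Submodule k M) : Prop :=
  Monotone E ∧ ∀ m : ℕ, finrank k ↥(E m) = min m (finrank k M)

/-- Membership of `V` in the (open) Schubert cell `Ω°_I(E_•) ⊆ Gr(r, M)` attached to the
subset `I ⊆ [n]` recorded by the strictly increasing tuple `i : Fin r → Fin n`
(`0`-indexed: the `1`-based subset is `{i a + 1}`): `dim (V ∩ E_u) = #{a | i_a ≤ u}`. -/
def cellMem {k M : Type*} [Field k] [AddCommGroup M] [Module k M] {n r : ℕ}
    (i : Fin r → Fin n) (E : ℕ → Submodule k M) (V : Submodule k M) : Prop :=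
  finrank k ↥V = r ∧
    ∀ u : ℕ, u ≤ n →
      finrank k ↥(V ⊓ E u) =
        (Finset.univ.filter (fun a : Fin r => (i a : ℕ) + 1 ≤ u)).card

/-- Membership of `V` in the (closed) Schubert variety `Ω_I(E_•) ⊆ Gr(r, M)`:
`dim (V ∩ E_{i_a}) ≥ a` for `a = 1, …, r`. -/
def varMem {k M : Type*} [Field k] [AddCommGroup M] [Module k M] {n r : ℕ}
    (i : Fin r → Fin n) (E : ℕ → Submodule k M) (V : Submodule k M) : Prop :=
  finrank k ↥V = r ∧ ∀ a : Fin r, (a : ℕ) + 1 ≤ finrank k ↥(V ⊓ E ((i a : ℕ) + 1))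

/-- The flag induced on a subspace `V` by a flag `E` on `M`: its `a`-th member is the
smallest subspace of the form `V ∩ E_u` of dimension `≥ a`. -/
def indSub {k M : Type*} [Field k] [AddCommGroup M] [Module k M]
    (E : ℕ → Submodule k M) (V : Submodule k M) : ℕ → Submodule k ↥V := fun a =>
  ⨅ u ∈ {u : ℕ | a ≤ finrank k ↥(Submodule.comap V.subtype (E u))},
    Submodule.comap V.subtype (E u)

/-- The flag induced on the quotient `M ⧸ V` by a flag `E` on `M`: its `b`-th member is
the smallest subspace of the form `(E_u + V)/V` of dimension `≥ b`. -/
def indQuot {k M : Type*} [Field k] [AddCommGroup M] [Module k M]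
    (E : ℕ → Submodule k M) (V : Submodule k M) : ℕ → Submodule k (M ⧸ V) := fun b =>
  ⨅ u ∈ {u : ℕ | b ≤ finrank k ↥(Submodule.map V.mkQ (E u))},
    Submodule.map V.mkQ (E u)

/-- The flag spanned by a tuple of vectors (a complete flag when the tuple is a basis). -/
def spanFlag (k : Type*) {M : Type*} [Field k] [AddCommGroup M] [Module k M] {r : ℕ}
    (b : Fin r → M) : ℕ → Submodule k M := fun m =>
  Submodule.span k (b '' {a : Fin r | (a : ℕ) < m})

/-- `P` holds for a generic point of `Fl(M)^s` (`r = dim M`): there is a nonempty Zariski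
open set of `s`-tuples of bases of `M` on which the associated tuples of complete flags
satisfy `P`. -/
def GenericFlags (k : Type*) {M : Type*} [Field k] [AddCommGroup M] [Module k M]
    (s r : ℕ) (P : (Fin s → ℕ → Submodule k M) → Prop) : Prop :=
  ∃ U : Set (Fin s → Fin r → M),
    @IsOpen _ (mZariski k (Fin s → Fin r → M)) U ∧
    (∃ b ∈ U, ∀ j, LinearIndependent k (b j)) ∧
    ∀ b ∈ U, (∀ j, LinearIndependent k (b j)) → P (fun j => spanFlag k (b j))

/-- `P` holds for a generic point of `Fl(M)^s × Fl(Q)^s` (`r = dim M`, `q = dim Q`). -/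
def GenericFlagPairs (k : Type*) {M Q : Type*} [Field k] [AddCommGroup M] [Module k M]
    [AddCommGroup Q] [Module k Q] (s r q : ℕ)
    (P : (Fin s → ℕ → Submodule k M) → (Fin s → ℕ → Submodule k Q) → Prop) : Prop :=
  ∃ U : Set ((Fin s → Fin r → M) × (Fin s → Fin q → Q)),
    @IsOpen _ (mZariski k ((Fin s → Fin r → M) × (Fin s → Fin q → Q))) U ∧
    (∃ b ∈ U, (∀ j, LinearIndependent k (b.1 j)) ∧ ∀ j, LinearIndependent k (b.2 j)) ∧
    ∀ b ∈ U, ((∀ j, LinearIndependent k (b.1 j)) ∧ ∀ j, LinearIndependent k (b.2 j)) →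
      P (fun j => spanFlag k (b.1 j)) (fun j => spanFlag k (b.2 j))

/-! ### The spaces `Hom_𝓘(V, Q, 𝓕, 𝓖)` -/

/-- The subspace `{φ : M →ₗ Q | φ(p) ⊆ q}` of `Hom(M, Q)`. -/
def homConstraint {k M Q : Type*} [Field k] [AddCommGroup M] [Module k M]
    [AddCommGroup Q] [Module k Q] (p : Submodule k M) (q : Submodule k Q) :
    Submodule k (M →ₗ[k] Q) :=
  LinearMap.ker ((LinearMap.llcomp k ↥p Q (Q ⧸ q) q.mkQ).comp (LinearMap.lcomp k Q p.subtype))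

/-- `Hom_𝓘(M, Q, F, G) = {φ | φ(F^j_a) ⊆ G^j_{i^j_a - a} for all a = 1, …, r, j = 1, …, s}`. -/
def homSpace {k M Q : Type*} [Field k] [AddCommGroup M] [Module k M]
    [AddCommGroup Q] [Module k Q] {n r s : ℕ} (I : Fin s → Fin r → Fin n)
    (F : Fin s → ℕ → Submodule k M) (G : Fin s → ℕ → Submodule k Q) :
    Submodule k (M →ₗ[k] Q) :=
  ⨅ j : Fin s, ⨅ a : Fin r,
    homConstraint (F j ((a : ℕ) + 1)) (G j ((I j a : ℕ) - (a : ℕ)))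

/-! ### Charts on the Grassmannian, tangent spaces to Schubert cells -/

/-- The graph of `ψ : V →ₗ C`, a point of the Grassmannian chart around `V`
determined by a complement `C` of `V`. -/
def graphMap {k M : Type*} [Field k] [AddCommGroup M] [Module k M]
    (V C : Submodule k M) (ψ : ↥V →ₗ[k] ↥C) : Submodule k M :=
  LinearMap.range (V.subtype + C.subtype ∘ₗ ψ)

/-- The canonical identification `Hom(V, C) ≃ Hom(V, M/V)` (derivative of the chart). -/
def conjMap {k M : Type*} [Field k] [AddCommGroup M] [Module k M]
    (V C : Submodule k M) : (↥V →ₗ[k] ↥C) →ₗ[k] (↥V →ₗ[k] M ⧸ V) :=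
  LinearMap.llcomp k ↥V ↥C (M ⧸ V) (V.mkQ ∘ₗ C.subtype)

/-- The tangent space at `V` to a set `S` of points of the Grassmannian `Gr(r, M)`,
computed in the chart determined by a complement `C` of `V` and viewed inside
`Hom(V, M/V)` via the canonical identification. -/
def grTangent {k M : Type*} [Field k] [AddCommGroup M] [Module k M]
    (S : Set (Submodule k M)) (V C : Submodule k M) :
    Submodule k (↥V →ₗ[k] (M ⧸ V)) :=
  Submodule.map (conjMap V C)
    (mTangent k {ψ : ↥V →ₗ[k] ↥C | graphMap V C ψ ∈ S} 0)

/-- The Zariski topology on the Grassmannian of `r`-dimensional subspaces of `M`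
(as a topology on `Submodule k M`), coinduced from the Stiefel parameterization by
spanning `r`-tuples. -/
def grTop (k : Type*) {M : Type*} [Field k] [AddCommGroup M] [Module k M] (r : ℕ) :
    TopologicalSpace (Submodule k M) :=
  TopologicalSpace.coinduced (fun b : Fin r → M => Submodule.span k (Set.range b))
    (mZariski k (Fin r → M))

/-! ### Numerical quantities -/

/-- `codim ω_I = ∑_{a=1}^r (n - r + a - i_a)` (as an integer). -/
def codimZ (n r : ℕ) (i : Fin r → Fin n) : ℤ :=
  ∑ a : Fin r, ((n : ℤ) - (r : ℤ) + ((a : ℕ) : ℤ) - ((i a : ℕ) : ℤ))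

/-- The quantity `∑_j ∑_{a ∈ K^j} (n - r + a - i^j_a) - d(n - r)` of Inequality `(†^𝓘_𝓚)`. -/
def daggerZ (n r d : ℕ) {s : ℕ} (I : Fin s → Fin r → Fin n)
    (K : Fin s → Fin d → Fin r) : ℤ :=
  (∑ j : Fin s, ∑ t : Fin d,
      ((n : ℤ) - (r : ℤ) + ((K j t : ℕ) : ℤ) - ((I j (K j t) : ℕ) : ℤ)))
    - (d : ℤ) * ((n : ℤ) - (r : ℤ))

/-- The expected dimension `dim(S, M, 𝓕) = d(m - d) - ∑_j ∑_{t=1}^d (m - d + t - k^j_t)`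
of an intersection of Schubert cells `Ω°_{K^j}` in `Gr(d, m)`. -/
def eDimZ {s : ℕ} (m d : ℕ) (K : Fin s → Fin d → Fin m) : ℤ :=
  (d : ℤ) * ((m : ℤ) - (d : ℤ)) -
    ∑ j : Fin s, ∑ t : Fin d,
      ((m : ℤ) - (d : ℤ) + ((t : ℕ) : ℤ) - ((K j t : ℕ) : ℤ))

/-- `codim ω_I` as a natural number. -/
def codimN (n r : ℕ) (i : Fin r → Fin n) : ℕ :=
  ∑ a : Fin r, ((n - r + (a : ℕ)) - (i a : ℕ))

/-! ### The cohomology ring of the Grassmannian, Schubert classes -/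

/-- The ideal `(h_{n-r+1}, …, h_n)` of the polynomial ring in `r` variables
(`h_m` the complete homogeneous symmetric polynomials). -/
def grassIdeal (r n : ℕ) : Ideal (MvPolynomial (Fin r) ℤ) :=
  Ideal.span ((fun m : ℕ => MvPolynomial.hsymm (Fin r) ℤ m) '' Set.Icc (n - r + 1) n)

/-- A presentation of the cohomology (Chow) ring `H^*(Gr(r,n))`: products of Schubert
classes vanish here exactly when they vanish in `H^*(Gr(r,n))`. -/
abbrev grassRing (r n : ℕ) : Type :=
  MvPolynomial (Fin r) ℤ ⧸ grassIdeal r n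

/-- `h_m` for an integer `m` (zero for negative `m`). -/
def hkZ (r : ℕ) (m : ℤ) : MvPolynomial (Fin r) ℤ :=
  if 0 ≤ m then MvPolynomial.hsymm (Fin r) ℤ m.toNat else 0

/-- The Schur polynomial (Jacobi–Trudi determinant) of the partition
`λ_a = n - r + a - i_a` attached to the subset `I ⊆ [n]` recorded by `i`. -/
def schurI {n r : ℕ} (i : Fin r → Fin n) : MvPolynomial (Fin r) ℤ :=
  Matrix.det (Matrix.of fun a b : Fin r =>
    hkZ r ((n : ℤ) - (r : ℤ) + ((b : ℕ) : ℤ) - ((i a : ℕ) : ℤ)))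

/-- The Schubert class `ω_I ∈ H^*(Gr(r,n))` of the subset `I ⊆ [n]` recorded by the
strictly increasing tuple `i : Fin r → Fin n`. -/
def omegaCls {n r : ℕ} (i : Fin r → Fin n) : grassRing r n :=
  Ideal.Quotient.mk (grassIdeal r n) (schurI i)

/-- The class of a point in `H^*(Gr(r,n))`: the Schubert class of `I = {1, …, r}`. -/
def pointCls (r n : ℕ) (h : r ≤ n) : grassRing r n :=
  omegaCls (fun a : Fin r => Fin.castLE h a)

/-! ### Schur polynomials of partitions, Littlewood–Richardson coefficients -/

/-- The Schur polynomial of a partition with at most `r` parts, via Jacobi–Trudi. -/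
def schurP {r : ℕ} (lam : Fin r → ℕ) : MvPolynomial (Fin r) ℤ :=
  Matrix.det (Matrix.of fun a b : Fin r =>
    hkZ r (((lam a : ℕ) : ℤ) - ((a : ℕ) : ℤ) + ((b : ℕ) : ℤ)))

/-- The Vandermonde alternant `a_δ = det(x_a^{r-1-b})`. -/
def alternant (r : ℕ) : MvPolynomial (Fin r) ℤ :=
  Matrix.det (Matrix.of fun a b : Fin r => (MvPolynomial.X a) ^ (r - 1 - (b : ℕ)))

/-- The coefficient of the Schur polynomial `s_δ` in a symmetric polynomial `f`
(in `r` variables): the coefficient of the monomial `x^{δ + (r-1, …, 1, 0)}` in `f ⬝ a_δ`. -/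
def schurCoeff (r : ℕ) (f : MvPolynomial (Fin r) ℤ) (δ : Fin r → ℕ) : ℤ :=
  MvPolynomial.coeff
    (Finsupp.equivFunOnFinite.symm (fun a : Fin r => δ a + (r - 1 - (a : ℕ))))
    (f * alternant r)

/-- The Littlewood–Richardson coefficient `c^λ_{μ,ν}` (partitions with at most `r` parts):
the multiplicity of `V_λ` in `V_μ ⊗ V_ν`, i.e. of `s_λ` in `s_μ s_ν`. -/
def lrCoeff (r : ℕ) (lam mu nu : Fin r → ℕ) : ℤ :=
  schurCoeff r (schurP mu * schurP nu) lam

/-- The multiplicity of `V_δ` in `V_{Λ 1} ⊗ ⋯ ⊗ V_{Λ t}` (as `GL(r)`-representations),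
i.e. of `s_δ` in `∏_j s_{Λ j}`. -/
def multiCoeff (r : ℕ) {t : ℕ} (Λ : Fin t → Fin r → ℕ) (δ : Fin r → ℕ) : ℤ :=
  schurCoeff r (∏ j : Fin t, schurP (Λ j)) δ

open Classical in
/-- Rows in normal form with respect to the span of `w` and the position `P`: for `l` outside
the range of `P` the row is `u l`; otherwise it is the combination, with coefficients `c l`, of
the vectors `w` and of the rows `u m` with `m < l` outside the range of `P`. -/
def schubertRows {A : Type*} [CommRing A] {n p : ℕ} (P : Fin p → Fin n)
    (w : Fin p → Fin n → A) (c u : Fin n → Fin n → A) : Fin n → Fin n → A := fun l i =>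
  if l ∈ Set.range P then
    ∑ m, (if m ∈ Set.range P ∨ m < l then c l m else 0) * Function.extend P w u m i
  else u l i

lemma schubertRows_of_notMem {A : Type*} [CommRing A] {n p : ℕ} {P : Fin p → Fin n}
    (w : Fin p → Fin n → A) (c u : Fin n → Fin n → A) {l : Fin n} (hl : l ∉ Set.range P) :
    schubertRows P w c u l = u l := by
  ext i
  simp only [schubertRows, if_neg hl]

open Classical in
lemma schubertRows_of_mem {A : Type*} [CommRing A] {n p : ℕ} {P : Fin p → Fin n}
    (w : Fin p → Fin n → A) (c u : Fin n → Fin n → A) {l : Fin n} (hl : l ∈ Set.range P) :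
    schubertRows P w c u l =
      ∑ m, (if m ∈ Set.range P ∨ m < l then c l m else 0) • Function.extend P w u m := by
  ext i
  simp only [schubertRows, if_pos hl, Finset.sum_apply, Pi.smul_apply, smul_eq_mul]

lemma map_extend_apply {A B : Type*} [CommRing A] [CommRing B] (φ : A →+* B) {n p : ℕ}
    (P : Fin p → Fin n) (w : Fin p → Fin n → A) (u : Fin n → Fin n → A) (m i : Fin n) :
    φ (Function.extend P w u m i) =
      Function.extend P (fun a i => φ (w a i)) (fun l i => φ (u l i)) m i := by
  by_cases h : ∃ a, P a = m
  · simp only [Function.extend, dif_pos h]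
  · simp only [Function.extend, dif_neg h]

lemma map_schubertRows {A B : Type*} [CommRing A] [CommRing B] (φ : A →+* B) {n p : ℕ}
    (P : Fin p → Fin n) (w : Fin p → Fin n → A) (c u : Fin n → Fin n → A) (l i : Fin n) :
    φ (schubertRows P w c u l i) =
      schubertRows P (fun a i => φ (w a i)) (fun l i => φ (c l i)) (fun l i => φ (u l i)) l i := by
  unfold schubertRows
  split_ifs
  · rw [map_sum]
    refine Finset.sum_congr rfl fun m _ => ?_
    rw [map_mul, map_extend_apply]
    split_ifs <;> simp
  · rfl

/-- The rows of a matrix can be put in normal form as soon as each row indexed by the range of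
`P` lies in the span of `w` and the preceding rows. -/
lemma exists_eq_schubertRows {K : Type*} [Field K] {n p : ℕ} {P : Fin p → Fin n}
    (hP : Function.Injective P) (w : Fin p → Fin n → K) (b : Fin n → Fin n → K)
    (h : ∀ l ∈ Set.range P, b l ∈ span K (Set.range w ∪ b '' {m | m < l})) :
    ∃ c, b = schubertRows P w c b := by
  classical
  have key : ∀ l : Fin n, l ∈ Set.range P → b l ∈ span K (Function.extend P w b ''
      ((Finset.univ.filter fun m => m ∈ Set.range P ∨ m < l : Finset (Fin n)) : Set (Fin n))) := by
    intro l
    induction l using WellFoundedLT.induction with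
    | ind l ih =>
      intro hl
      refine span_le.2 ?_ (h l hl)
      rintro _ (⟨a, rfl⟩ | ⟨m, hm, rfl⟩)
      · refine subset_span ⟨P a, by simp, hP.extend_apply _ _ _⟩
      · by_cases hmP : m ∈ Set.range P
        · refine span_mono (Set.image_mono ?_) (ih m hm hmP)
          intro q hq
          simp only [Finset.coe_filter, Finset.mem_univ, true_and, Set.mem_ofPred_eq] at hq ⊢
          exact hq.imp_right fun h => h.trans hm
        · refine subset_span ⟨m, ?_, Function.extend_apply' _ _ _ hmP⟩
          simpa using Or.inr hm
  have key2 : ∀ l : Fin n, ∃ c : Fin n → K, l ∈ Set.range P →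
      b l = ∑ m, (if m ∈ Set.range P ∨ m < l then c m else 0) • Function.extend P w b m := by
    intro l
    by_cases hl : l ∈ Set.range P
    · obtain ⟨c, hc⟩ := (mem_span_image_finset_iff_exists_fun K).1 (key l hl)
      refine ⟨fun m => if hm : m ∈ Finset.univ.filter fun m => m ∈ Set.range P ∨ m < l
        then c ⟨m, hm⟩ else 0, fun _ => ?_⟩
      simp only [ite_smul, zero_smul]
      rw [← hc, ← Finset.sum_filter]
      refine Eq.trans ?_ (Finset.sum_coe_sort _ _)
      exact Finset.sum_congr rfl fun m _ => by rw [dif_pos m.2]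
    · exact ⟨0, fun h => absurd h hl⟩
  choose c hc using key2
  refine ⟨c, funext fun l => ?_⟩
  by_cases hl : l ∈ Set.range P
  · rw [schubertRows_of_mem _ _ _ hl]
    exact hc l hl
  · rw [schubertRows_of_notMem _ _ _ hl]

/-- The number of free coefficients in the `l`-th row of a normal form. -/
def rowParams {n p : ℕ} (P : Fin p → Fin n) (l : Fin n) : ℕ :=
  Nat.card {m : Fin n // l ∈ Set.range P → m ∈ Set.range P ∨ m < l}

lemma mem_matroid_closure_of_mem_adjoin {k K : Type*} [Field k] [Field K] [Algebra k K]
    {s : Set K} {x : K} (hx : x ∈ IntermediateField.adjoin k s) :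
    x ∈ (AlgebraicIndependent.matroid k K).closure s := by
  rw [AlgebraicIndependent.matroid_closure_eq, SetLike.mem_coe, Subalgebra.mem_algebraicClosure]
  obtain ⟨a, ha, b, hb, rfl⟩ := IntermediateField.mem_adjoin_iff_div.1 hx
  rw [div_eq_mul_inv]
  exact (isAlgebraic_algebraMap (⟨a, ha⟩ : Algebra.adjoin k s)).mul
    (isAlgebraic_algebraMap (⟨b, hb⟩ : Algebra.adjoin k s)).inv

lemma eRk_le_of_subset_adjoin {k K : Type*} [Field k] [Field K] [Algebra k K]
    {s t : Set K} (h : t ⊆ IntermediateField.adjoin k s) :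
    (AlgebraicIndependent.matroid k K).eRk t ≤ (AlgebraicIndependent.matroid k K).eRk s := by
  rw [← Matroid.eRk_closure_eq _ s]
  exact Matroid.eRk_mono _ fun x hx => mem_matroid_closure_of_mem_adjoin (h hx)

lemma eRk_schubertRows_le (k : Type*) {K : Type*} [Field k] [Field K] [Algebra k K] {n p s : ℕ}
    {P : Fin s → Fin p → Fin n} (hP : ∀ j, Function.Injective (P j))
    (w : Fin p → Fin n → K) (b : Fin s → Fin n → Fin n → K)
    (h : ∀ j, ∀ l ∈ Set.range (P j), b j l ∈ span K (Set.range w ∪ b j '' {m | m < l})) :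
    (AlgebraicIndependent.matroid k K).eRk
      (Set.range (fun q : Fin p × Fin n => w q.1 q.2) ∪
        Set.range (fun q : Fin s × Fin n × Fin n => b q.1 q.2.1 q.2.2)) ≤
      ((p * n + ∑ j, ∑ l, rowParams (P j) l : ℕ) : ℕ∞) := by
  classical
  choose c hc using fun j => exists_eq_schubertRows (hP j) w (b j) (h j)
  let g : (Fin p × Fin n) ⊕ (Σ j : Fin s, Σ l : Fin n,
      {m : Fin n // l ∈ Set.range (P j) → m ∈ Set.range (P j) ∨ m < l}) → K :=
    Sum.elim (fun q => w q.1 q.2)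
      (fun q => if q.2.1 ∈ Set.range (P q.1) then c q.1 q.2.1 q.2.2 else b q.1 q.2.1 q.2.2)
  have hsub : (Set.range (fun q : Fin p × Fin n => w q.1 q.2) ∪
        Set.range (fun q : Fin s × Fin n × Fin n => b q.1 q.2.1 q.2.2)) ⊆
      IntermediateField.adjoin k (Set.range g) := by
    have hw : ∀ a i, w a i ∈ IntermediateField.adjoin k (Set.range g) := fun a i =>
      IntermediateField.subset_adjoin _ _ ⟨Sum.inl (a, i), rfl⟩
    have hb : ∀ j l i, l ∉ Set.range (P j) →
        b j l i ∈ IntermediateField.adjoin k (Set.range g) := fun j l i hl =>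
      IntermediateField.subset_adjoin _ _
        ⟨Sum.inr ⟨j, l, i, fun h => absurd h hl⟩, by simp only [g, Sum.elim_inr, if_neg hl]⟩
    rintro _ (⟨⟨a, i⟩, rfl⟩ | ⟨⟨j, l, i⟩, rfl⟩)
    · exact hw a i
    · by_cases hl : l ∈ Set.range (P j)
      · dsimp only
        rw [hc j]
        simp only [schubertRows, if_pos hl]
        refine sum_mem fun m _ => mul_mem ?_ ?_
        · split_ifs with hm
          · exact IntermediateField.subset_adjoin _ _
              ⟨Sum.inr ⟨j, l, m, fun _ => hm⟩, by simp only [g, Sum.elim_inr, if_pos hl]⟩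
          · exact zero_mem _
        · by_cases hm : m ∈ Set.range (P j)
          · obtain ⟨a, rfl⟩ := hm
            rw [(hP j).extend_apply]
            exact hw a i
          · rw [Function.extend_apply' _ _ _ hm]
            exact hb j m i hm
      · exact hb j l i hl
  refine (eRk_le_of_subset_adjoin hsub).trans ((Matroid.eRk_le_encard _ _).trans ?_)
  rw [← Set.image_univ]
  refine (Set.encard_image_le _ _).trans ?_
  rw [Set.encard_univ, ENat.card_eq_coe_natCard, Nat.card_sum, Nat.card_prod, Nat.card_sigma]
  simp only [Nat.card_sigma, Nat.card_eq_fintype_card (α := Fin _), Fintype.card_fin, rowParams,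
    le_refl]

/-- Solutions of an invertible linear system lie in the field generated by its coefficients. -/
lemma mem_of_sum_mul_mem {k K : Type*} [Field k] [Field K] [Algebra k K]
    (F : IntermediateField k K) {n : ℕ} {N : Fin n → Fin n → K} (hN : ∀ m i, N m i ∈ F)
    (hdet : (Matrix.of N).det ≠ 0) {c : Fin n → K} (hc : ∀ i, ∑ m, c m * N m i ∈ F) (m : Fin n) :
    c m ∈ F := by
  let N' : Matrix (Fin n) (Fin n) F := Matrix.of fun m i => ⟨N m i, hN m i⟩
  have hmap : N'.map (algebraMap F K) = Matrix.of N := by ext; rfl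
  have hdet' : IsUnit N'.det := by
    rw [isUnit_iff_ne_zero]
    intro h0
    apply hdet
    rw [← hmap, ← RingHom.mapMatrix_apply, ← RingHom.map_det, h0, map_zero]
  let y : Fin n → F := fun i => ⟨_, hc i⟩
  have hy : Matrix.vecMul c (Matrix.of N) = fun i => algebraMap F K (y i) := by
    ext i; rfl
  have h1 : Matrix.of N * (N'⁻¹).map (algebraMap F K) = 1 := by
    rw [← hmap, ← Matrix.map_mul, Matrix.mul_nonsing_inv _ hdet']
    exact Matrix.map_one _ (map_zero _) (map_one _)
  have h2 : c = fun i => algebraMap F K (Matrix.vecMul y N'⁻¹ i) := by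
    calc c = Matrix.vecMul (Matrix.vecMul c (Matrix.of N)) ((N'⁻¹).map (algebraMap F K)) := by
          rw [Matrix.vecMul_vecMul, h1, Matrix.vecMul_one]
      _ = _ := by
          rw [hy]
          ext i
          exact (RingHom.map_vecMul (algebraMap F K) N'⁻¹ y i).symm
  rw [h2]
  exact SetLike.coe_mem _

lemma rowParams_of_notMem {n p : ℕ} {P : Fin p → Fin n} {l : Fin n} (hl : l ∉ Set.range P) :
    rowParams P l = n := by
  rw [rowParams, Nat.card_congr (Equiv.subtypeUnivEquiv fun m h => absurd h hl)]
  simp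

lemma rowParams_apply {n p : ℕ} {P : Fin p → Fin n} (hP : StrictMono P) (a : Fin p) :
    rowParams P (P a) + a = p + P a := by
  classical
  have h1 : rowParams P (P a) = (Finset.univ.image P ∪ Finset.Iio (P a)).card := by
    rw [rowParams, Nat.card_eq_fintype_card, Fintype.card_subtype]
    congr 1
    ext m
    simp
  have h2 : Finset.univ.image P ∩ Finset.Iio (P a) = (Finset.Iio a).image P := by
    ext m
    simp only [Finset.mem_inter, Finset.mem_image, Finset.mem_univ, true_and, Finset.mem_Iio]
    constructor
    · rintro ⟨⟨q, rfl⟩, h⟩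
      exact ⟨q, hP.lt_iff_lt.1 h, rfl⟩
    · rintro ⟨q, h, rfl⟩
      exact ⟨⟨q, rfl⟩, hP h⟩
  have h3 := Finset.card_union_add_card_inter (Finset.univ.image P) (Finset.Iio (P a))
  rw [h2, Finset.card_image_of_injective _ hP.injective,
    Finset.card_image_of_injective _ hP.injective, ← h1] at h3
  simpa using h3

/-- The vectors with coordinates `z` with respect to the vectors `v`. -/
def subRows {A : Type*} [CommRing A] {n r d : ℕ} (v : Fin r → Fin n → A) (z : Fin d → Fin r → A) :
    Fin d → Fin n → A := fun t i => ∑ a, z t a * v a i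

/-- Tuples of rows spanning flags in prescribed position with respect to the span of `v` and to
its subspace spanned by `subRows v z`. -/
def nestedRows {A : Type*} [CommRing A] {n r d s : ℕ} (I : Fin s → Fin r → Fin n)
    (K : Fin s → Fin d → Fin r) (v : Fin r → Fin n → A) (z : Fin d → Fin r → A)
    (x : Fin s → Fin n → Fin n → A) : Fin s → Fin n → Fin n → A := fun j =>
  schubertRows (I j ∘ K j) (subRows v z) (x j) (schubertRows (I j) v (x j) (x j))

lemma map_subRows {A B : Type*} [CommRing A] [CommRing B] (φ : A →+* B) {n r d : ℕ}
    (v : Fin r → Fin n → A) (z : Fin d → Fin r → A) (t : Fin d) (i : Fin n) :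
    φ (subRows v z t i) = subRows (fun a i => φ (v a i)) (fun t a => φ (z t a)) t i := by
  simp [subRows]

lemma map_nestedRows {A B : Type*} [CommRing A] [CommRing B] (φ : A →+* B) {n r d s : ℕ}
    (I : Fin s → Fin r → Fin n) (K : Fin s → Fin d → Fin r) (v : Fin r → Fin n → A)
    (z : Fin d → Fin r → A) (x : Fin s → Fin n → Fin n → A) (j : Fin s) (l i : Fin n) :
    φ (nestedRows I K v z x j l i) = nestedRows I K (fun a i => φ (v a i))
      (fun t a => φ (z t a)) (fun j l i => φ (x j l i)) j l i := by
  simp only [nestedRows, map_schubertRows, map_subRows]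

section nestedRows

variable {n r d s : ℕ} {I : Fin s → Fin r → Fin n} {K : Fin s → Fin d → Fin r}

lemma nestedRows_of_notMem {A : Type*} [CommRing A] (v : Fin r → Fin n → A)
    (z : Fin d → Fin r → A) (x : Fin s → Fin n → Fin n → A) {j : Fin s} {l : Fin n}
    (hl : l ∉ Set.range (I j ∘ K j)) :
    nestedRows I K v z x j l = schubertRows (I j) v (x j) (x j) l :=
  schubertRows_of_notMem _ _ _ hl

lemma notMem_range_comp {j : Fin s} {l : Fin n} (hl : l ∉ Set.range (I j)) :
    l ∉ Set.range (I j ∘ K j) := fun h => hl (Set.range_comp_subset_range _ _ h)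

lemma nestedRows_of_notMem' {A : Type*} [CommRing A] (v : Fin r → Fin n → A)
    (z : Fin d → Fin r → A) (x : Fin s → Fin n → Fin n → A) {j : Fin s} {l : Fin n}
    (hl : l ∉ Set.range (I j)) : nestedRows I K v z x j l = x j l :=
  (nestedRows_of_notMem v z x (notMem_range_comp hl)).trans (schubertRows_of_notMem _ _ _ hl)

lemma extend_nestedRows {A : Type*} [CommRing A] (v : Fin r → Fin n → A)
    (z : Fin d → Fin r → A) (x : Fin s → Fin n → Fin n → A) (j : Fin s) (m : Fin n) :
    Function.extend (I j) v (nestedRows I K v z x j) m = Function.extend (I j) v (x j) m := by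
  by_cases hm : ∃ a, I j a = m
  · simp only [Function.extend, dif_pos hm]
  · rw [Function.extend_apply' _ _ _ hm, Function.extend_apply' _ _ _ hm]
    exact nestedRows_of_notMem' v z x hm

lemma extend_comp_nestedRows {A : Type*} [CommRing A] (v : Fin r → Fin n → A)
    (z : Fin d → Fin r → A) (x : Fin s → Fin n → Fin n → A) (j : Fin s) (m : Fin n) :
    Function.extend (I j ∘ K j) (subRows v z) (nestedRows I K v z x j) m =
      Function.extend (I j ∘ K j) (subRows v z) (schubertRows (I j) v (x j) (x j)) m := by
  by_cases hm : ∃ a, (I j ∘ K j) a = m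
  · simp only [Function.extend, dif_pos hm]
  · rw [Function.extend_apply' _ _ _ hm, Function.extend_apply' _ _ _ hm]
    exact nestedRows_of_notMem v z x hm

lemma nestedRows_mem_span_sub {F : Type*} [Field F] (hI : ∀ j, Function.Injective (I j))
    (hK : ∀ j, Function.Injective (K j)) (v : Fin r → Fin n → F)
    (z : Fin d → Fin r → F) (x : Fin s → Fin n → Fin n → F) (j : Fin s) (l : Fin n)
    (hl : l ∈ Set.range (I j ∘ K j)) :
    nestedRows I K v z x j l ∈
      span F (Set.range (subRows v z) ∪ nestedRows I K v z x j '' {m | m < l}) := by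
  rw [nestedRows, schubertRows_of_mem _ _ _ hl]
  refine sum_mem fun m _ => ?_
  rw [← extend_comp_nestedRows (I := I) (K := K)]
  split_ifs with hm
  · refine smul_mem _ _ (subset_span ?_)
    by_cases hm' : m ∈ Set.range (I j ∘ K j)
    · obtain ⟨a, rfl⟩ := hm'
      rw [((hI j).comp (hK j)).extend_apply]
      exact Or.inl ⟨a, rfl⟩
    · rw [Function.extend_apply' _ _ _ hm']
      exact Or.inr ⟨m, hm.resolve_left hm', rfl⟩
  · rw [zero_smul]
    exact zero_mem _

lemma nestedRows_mem_span {F : Type*} [Field F] (hI : ∀ j, Function.Injective (I j))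
    (hK : ∀ j, Function.Injective (K j)) (v : Fin r → Fin n → F)
    (z : Fin d → Fin r → F) (x : Fin s → Fin n → Fin n → F) (j : Fin s) (l : Fin n)
    (hl : l ∈ Set.range (I j)) :
    nestedRows I K v z x j l ∈
      span F (Set.range v ∪ nestedRows I K v z x j '' {m | m < l}) := by
  by_cases hlL : l ∈ Set.range (I j ∘ K j)
  · refine span_le.2 ?_ (nestedRows_mem_span_sub hI hK v z x j l hlL)
    rintro _ (⟨t, rfl⟩ | h)
    · have : subRows v z t = ∑ a, z t a • v a := by
        ext i
        simp [subRows]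
      rw [this]
      exact sum_mem fun a _ => smul_mem _ _ (subset_span (Or.inl ⟨a, rfl⟩))
    · exact subset_span (Or.inr h)
  · rw [nestedRows_of_notMem v z x hlL, schubertRows_of_mem _ _ _ hl]
    refine sum_mem fun m _ => ?_
    rw [← extend_nestedRows (I := I) (K := K) v z]
    split_ifs with hm
    · refine smul_mem _ _ (subset_span ?_)
      by_cases hm' : m ∈ Set.range (I j)
      · obtain ⟨a, rfl⟩ := hm'
        rw [(hI j).extend_apply]
        exact Or.inl ⟨a, rfl⟩
      · rw [Function.extend_apply' _ _ _ hm']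
        exact Or.inr ⟨m, hm.resolve_left hm', rfl⟩
    · rw [zero_smul]
      exact zero_mem _

/-- The coefficients of `nestedRows` are rational functions of the rows and of the spanning
vectors of the two subspaces. -/
lemma nestedRows_params_mem {k F : Type*} [Field k] [Field F] [Algebra k F]
    (hI : ∀ j, Function.Injective (I j)) (hK : ∀ j, Function.Injective (K j))
    (v : Fin r → Fin n → F) (z : Fin d → Fin r → F) (x : Fin s → Fin n → Fin n → F)
    (E : IntermediateField k F) (hv : ∀ a i, v a i ∈ E) (hw : ∀ t i, subRows v z t i ∈ E)
    (hb : ∀ j l i, nestedRows I K v z x j l i ∈ E)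
    (hdetV : ∀ j, (Matrix.of (Function.extend (I j) v (nestedRows I K v z x j))).det ≠ 0)
    (hdetS : ∀ j, (Matrix.of (Function.extend (I j ∘ K j) (subRows v z)
      (nestedRows I K v z x j))).det ≠ 0) (hs : 0 < s) :
    (∀ t a, z t a ∈ E) ∧ (∀ j l m, l ∈ Set.range (I j ∘ K j) →
      (m ∈ Set.range (I j ∘ K j) ∨ m < l) → x j l m ∈ E) ∧
      ∀ j l m, l ∉ Set.range (I j ∘ K j) →
        (l ∈ Set.range (I j) → m ∈ Set.range (I j) ∨ m < l) → x j l m ∈ E := by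
  classical
  have hNV : ∀ j m i, Function.extend (I j) v (nestedRows I K v z x j) m i ∈ E := by
    intro j m i
    by_cases hm : m ∈ Set.range (I j)
    · obtain ⟨a, rfl⟩ := hm
      rw [(hI j).extend_apply]
      exact hv a i
    · rw [Function.extend_apply' _ _ _ hm]
      exact hb j m i
  have hNS : ∀ j m i,
      Function.extend (I j ∘ K j) (subRows v z) (nestedRows I K v z x j) m i ∈ E := by
    intro j m i
    by_cases hm : m ∈ Set.range (I j ∘ K j)
    · obtain ⟨a, rfl⟩ := hm
      rw [((hI j).comp (hK j)).extend_apply]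
      exact hw a i
    · rw [Function.extend_apply' _ _ _ hm]
      exact hb j m i
  refine ⟨fun t a => ?_, fun j l m hl hm => ?_, fun j l m hlL hm => ?_⟩
  · let j : Fin s := ⟨0, hs⟩
    have h := mem_of_sum_mul_mem E (hNV j) (hdetV j)
      (c := Function.extend (I j) (z t) 0) (fun i => ?_) (I j a)
    · rwa [(hI j).extend_apply] at h
    · have h2 : ∑ m, Function.extend (I j) (z t) 0 m *
          Function.extend (I j) v (nestedRows I K v z x j) m i = subRows v z t i := by
        rw [← Finset.sum_subset (Finset.subset_univ (Finset.univ.image (I j)))]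
        · rw [Finset.sum_image (fun a _ b _ h => hI j h)]
          simp only [(hI j).extend_apply, subRows]
        · intro m _ hm
          rw [Function.extend_apply' _ _ m (by simpa using hm), Pi.zero_apply, zero_mul]
      rw [h2]
      exact hw t i
  · have h := mem_of_sum_mul_mem E (hNS j) (hdetS j)
      (c := fun m => if m ∈ Set.range (I j ∘ K j) ∨ m < l then x j l m else 0) (fun i => ?_) m
    · simpa only [if_pos hm] using h
    · have h2 := congrFun (schubertRows_of_mem (P := I j ∘ K j) (subRows v z) (x j)
        (schubertRows (I j) v (x j) (x j)) hl) i
      have h3 := hb j l i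
      rw [nestedRows, h2] at h3
      simp only [Finset.sum_apply, Pi.smul_apply, smul_eq_mul] at h3
      convert h3 using 3
      rw [extend_comp_nestedRows]
  · by_cases hl : l ∈ Set.range (I j)
    · have h := mem_of_sum_mul_mem E (hNV j) (hdetV j)
        (c := fun m => if m ∈ Set.range (I j) ∨ m < l then x j l m else 0) (fun i => ?_) m
      · simpa only [if_pos (hm hl)] using h
      · have h2 := congrFun (schubertRows_of_mem (P := I j) v (x j) (x j) hl) i
        have h3 := hb j l i
        rw [nestedRows_of_notMem v z x hlL, h2] at h3
        simp only [Finset.sum_apply, Pi.smul_apply, smul_eq_mul] at h3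
        convert h3 using 3
        rw [extend_nestedRows]
    · have h3 := hb j l m
      rwa [nestedRows_of_notMem' v z x hl] at h3

end nestedRows

lemma eRk_range_of_algebraicIndependent {k F ι : Type*} [Field k] [Field F] [Algebra k F]
    [Finite ι] {g : ι → F} (hg : AlgebraicIndependent k g) :
    (AlgebraicIndependent.matroid k F).eRk (Set.range g) = Nat.card ι := by
  have h : (AlgebraicIndependent.matroid k F).Indep (Set.range g) :=
    AlgebraicIndependent.matroid_indep_iff.2 hg.coe_range
  rw [h.eRk_eq_encard, ← Set.image_univ, hg.injective.encard_image, Set.encard_univ,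
    ENat.card_eq_coe_natCard]

lemma schubertRows_diagonal {A : Type*} [CommRing A] {n p : ℕ} {P : Fin p → Fin n}
    (hP : Function.Injective P) {w : Fin p → Fin n → A} {u e : Fin n → Fin n → A}
    (hw : ∀ a, w a = e (P a)) (hu : ∀ l, l ∉ Set.range P → u l = e l) :
    schubertRows P w (fun l m => if m = l then 1 else 0) u = e := by
  classical
  funext l
  by_cases hl : l ∈ Set.range P
  · rw [schubertRows_of_mem _ _ _ hl, Finset.sum_eq_single l]
    · obtain ⟨a, rfl⟩ := hl
      rw [hP.extend_apply, if_pos (Or.inl ⟨a, rfl⟩), if_pos rfl, one_smul, hw]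
    · intro m _ hm
      simp [hm]
    · simp
  · rw [schubertRows_of_notMem _ _ _ hl, hu l hl]

lemma extend_diagonal {A : Type*} {n p : ℕ} {P : Fin p → Fin n}
    (hP : Function.Injective P) {w : Fin p → Fin n → A} {e : Fin n → Fin n → A}
    (hw : ∀ a, w a = e (P a)) : Function.extend P w e = e := by
  funext m
  by_cases hm : m ∈ Set.range P
  · obtain ⟨a, rfl⟩ := hm
    rw [hP.extend_apply, hw]
  · rw [Function.extend_apply' _ _ _ hm]

lemma sum_range_eq_sum_comp {n p : ℕ} {P : Fin p → Fin n} (hP : Function.Injective P)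
    (f : Fin n → ℤ) [DecidablePred (· ∈ Set.range P)] :
    ∑ l, (if l ∈ Set.range P then f l else 0) = ∑ t, f (P t) := by
  classical
  rw [← Finset.sum_filter, ← Finset.sum_image (f := f) (fun a _ b _ h => hP h)]
  congr 1
  ext l
  simp

open Classical in
lemma daggerZ_nonpos_of_params_le {n r d s : ℕ} {I : Fin s → Fin r → Fin n}
    {K : Fin s → Fin d → Fin r} (hI : ∀ j, StrictMono (I j)) (hK : ∀ j, StrictMono (K j))
    (h : s * (n * n) + (r * n + (d * r + ∑ j, ∑ l, if l ∈ Set.range (I j ∘ K j)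
        then rowParams (I j ∘ K j) l else rowParams (I j) l)) ≤
      (r * n + ∑ j, ∑ l, rowParams (I j) l) + (d * n + ∑ j, ∑ l, rowParams (I j ∘ K j) l)) :
    daggerZ n r d I K ≤ 0 := by
  have hrow : ∀ j l, (rowParams (I j) l : ℤ) + rowParams (I j ∘ K j) l =
      n + (if l ∈ Set.range (I j ∘ K j)
        then (rowParams (I j ∘ K j) l : ℤ) else rowParams (I j) l) +
      (if l ∈ Set.range (I j ∘ K j) then (rowParams (I j) l : ℤ) - n else 0) := by
    intro j l
    split_ifs with hl
    · ring
    · rw [rowParams_of_notMem hl]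
      ring
  have hj : ∀ j, ∑ l, (rowParams (I j) l : ℤ) + ∑ l, (rowParams (I j ∘ K j) l : ℤ) =
      n * n + ∑ l, (if l ∈ Set.range (I j ∘ K j)
        then (rowParams (I j ∘ K j) l : ℤ) else rowParams (I j) l) -
      ∑ t : Fin d, ((n : ℤ) - r + (K j t : ℕ) - (I j (K j t) : ℕ)) := by
    intro j
    rw [← Finset.sum_add_distrib, Finset.sum_congr rfl fun l _ => hrow j l,
      Finset.sum_add_distrib, Finset.sum_add_distrib,
      sum_range_eq_sum_comp ((hI j).injective.comp (hK j).injective), sub_eq_add_neg,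
      ← Finset.sum_neg_distrib]
    congr 1
    · simp
    · refine Finset.sum_congr rfl fun t _ => ?_
      have := rowParams_apply (hI j) (K j t)
      simp only [Function.comp_apply]
      omega
  have h' : (s : ℤ) * (n * n) + (r * n + (d * r + ∑ j, ∑ l, if l ∈ Set.range (I j ∘ K j)
        then (rowParams (I j ∘ K j) l : ℤ) else rowParams (I j) l)) ≤
      (r * n + ∑ j, ∑ l, (rowParams (I j) l : ℤ)) +
        (d * n + ∑ j, ∑ l, (rowParams (I j ∘ K j) l : ℤ)) := by
    exact_mod_cast h
  have hsum := Finset.sum_congr (rfl : (Finset.univ : Finset (Fin s)) = Finset.univ)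
    fun j _ => hj j
  rw [Finset.sum_add_distrib, Finset.sum_sub_distrib, Finset.sum_add_distrib] at hsum
  simp only [Finset.sum_const, Finset.card_univ, Fintype.card_fin, nsmul_eq_mul] at hsum
  unfold daggerZ
  linarith

/-- If the expected dimension inequality fails for the position `(I, K)`, the tuples of flags
admitting a pair of nested subspaces in this position lie in a hypersurface. -/
theorem exists_polynomial_vanishing_on_nestedRows (k : Type*) [Field k] {n r d s : ℕ} (hs : 0 < s)
    {I : Fin s → Fin r → Fin n} {K : Fin s → Fin d → Fin r} (hI : ∀ j, StrictMono (I j))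
    (hK : ∀ j, StrictMono (K j)) (hdagger : ¬ daggerZ n r d I K ≤ 0) :
    ∃ f : MvPolynomial (Fin s × Fin n × Fin n) k, f ≠ 0 ∧
      ∀ (v : Fin r → Fin n → k) (z : Fin d → Fin r → k) (x : Fin s → Fin n → Fin n → k),
        MvPolynomial.eval (fun q => nestedRows I K v z x q.1 q.2.1 q.2.2) f = 0 := by
  classical
  let σ := (Fin r × Fin n) ⊕ (Fin d × Fin r) ⊕ (Fin s × Fin n × Fin n)
  let R := MvPolynomial σ k
  let F := FractionRing R
  let vR : Fin r → Fin n → R := fun a i => MvPolynomial.X (Sum.inl (a, i))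
  let zR : Fin d → Fin r → R := fun t a => MvPolynomial.X (Sum.inr (Sum.inl (t, a)))
  let xR : Fin s → Fin n → Fin n → R := fun j l i =>
    MvPolynomial.X (Sum.inr (Sum.inr (j, l, i)))
  let ι : R →ₐ[k] F := IsScalarTower.toAlgHom k R F
  have hι : Function.Injective ι := IsFractionRing.injective R F
  let g : σ → F := fun q => ι (MvPolynomial.X q)
  have hg : AlgebraicIndependent k g := (MvPolynomial.algebraicIndependent_X σ k).map' hι
  let v : Fin r → Fin n → F := fun a i => ι (vR a i)
  let z : Fin d → Fin r → F := fun t a => ι (zR t a)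
  let x : Fin s → Fin n → Fin n → F := fun j l i => ι (xR j l i)
  have hbι : ∀ j l i, ι (nestedRows I K vR zR xR j l i) = nestedRows I K v z x j l i :=
    map_nestedRows ι.toRingHom I K vR zR xR
  have hwι : ∀ t i, ι (subRows vR zR t i) = subRows v z t i := map_subRows ι.toRingHom vR zR
  have hinjL : ∀ j, Function.Injective (I j ∘ K j) := fun j =>
    (hI j).injective.comp (hK j).injective
  let b : Fin s × Fin n × Fin n → F := fun q => nestedRows I K v z x q.1 q.2.1 q.2.2
  by_cases hb : AlgebraicIndependent k b
  · exfalso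
    apply hdagger
    let e : Fin n → Fin n → k := fun m i => if i = m then 1 else 0
    have hspecial : ∀ j : Fin s, ∃ φ : R →+* k,
        (∀ m i, φ (Function.extend (I j) vR (nestedRows I K vR zR xR j) m i) = e m i) ∧
        ∀ m i, φ (Function.extend (I j ∘ K j) (subRows vR zR) (nestedRows I K vR zR xR j) m i) =
          e m i := by
      intro j
      let φ : R →+* k := MvPolynomial.eval (Sum.elim (fun q => e (I j q.1) q.2)
        (Sum.elim (fun q => if q.2 = K j q.1 then 1 else 0) (fun q => e q.2.1 q.2.2)))
      have hφv : (fun a i => φ (vR a i)) = fun a => e (I j a) := by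
        funext a i
        exact MvPolynomial.eval_X _
      have hφz : (fun t a => φ (zR t a)) = fun t a => if a = K j t then 1 else 0 := by
        funext t a
        exact MvPolynomial.eval_X _
      have hφx : (fun j l i => φ (xR j l i)) = fun _ => e := by
        funext j l i
        exact MvPolynomial.eval_X _
      have hsub : subRows (fun a => e (I j a)) (fun t a => if a = K j t then (1 : k) else 0) =
          fun t => e ((I j ∘ K j) t) := by
        funext t i
        simp [subRows]
      have hφw : (fun t i => φ (subRows vR zR t i)) = fun t => e ((I j ∘ K j) t) := by
        rw [← hsub, ← hφv, ← hφz]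
        funext t i
        exact map_subRows φ vR zR t i
      have hφb : (fun l i => φ (nestedRows I K vR zR xR j l i)) = e := by
        funext l i
        rw [map_nestedRows, hφv, hφz, hφx]
        have h1 : schubertRows (I j) (fun a => e (I j a)) e e = e :=
          schubertRows_diagonal (hI j).injective (fun a => rfl) fun l _ => rfl
        have h2 : schubertRows (I j ∘ K j) (fun t => e ((I j ∘ K j) t)) e e = e :=
          schubertRows_diagonal (hinjL j) (fun a => rfl) fun l _ => rfl
        rw [nestedRows, hsub, h1, h2]
      refine ⟨φ, fun m i => ?_, fun m i => ?_⟩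
      · rw [map_extend_apply, hφv, hφb]
        exact congrFun (congrFun (extend_diagonal (hI j).injective fun a => rfl) m) i
      · rw [map_extend_apply, hφw, hφb]
        exact congrFun (congrFun (extend_diagonal (hinjL j) fun a => rfl) m) i
    have hdet : ∀ (N : Fin n → Fin n → R) (φ : R →+* k), (∀ m i, φ (N m i) = e m i) →
        (Matrix.of fun m i => ι (N m i)).det ≠ 0 := by
      intro N φ hN h0
      have h1 : (Matrix.of fun m i => ι (N m i)) = ι.toRingHom.mapMatrix (Matrix.of N) := rfl
      rw [h1, ← RingHom.map_det] at h0
      have h2 : (Matrix.of N).det = 0 := hι (h0.trans (map_zero ι).symm)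
      have h3 : φ.mapMatrix (Matrix.of N) = 1 := by
        ext m i
        exact (hN m i).trans (by simp [e, Matrix.one_apply, eq_comm])
      have h4 := congrArg φ h2
      rw [RingHom.map_det, h3, Matrix.det_one, map_zero] at h4
      exact one_ne_zero h4
    have hdetV : ∀ j,
        (Matrix.of (Function.extend (I j) v (nestedRows I K v z x j))).det ≠ 0 := by
      intro j
      obtain ⟨φ, h, -⟩ := hspecial j
      convert hdet _ φ h using 3
      funext m i
      refine (congrFun (congrFun ?_ m) i).trans (map_extend_apply ι.toRingHom _ _ _ m i).symm
      congr 1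
      funext l i
      exact (hbι j l i).symm
    have hdetS : ∀ j, (Matrix.of (Function.extend (I j ∘ K j) (subRows v z)
        (nestedRows I K v z x j))).det ≠ 0 := by
      intro j
      obtain ⟨φ, -, h⟩ := hspecial j
      convert hdet _ φ h using 3
      funext m i
      refine (congrFun (congrFun ?_ m) i).trans (map_extend_apply ι.toRingHom _ _ _ m i).symm
      congr 1
      · funext t i
        exact (hwι t i).symm
      · funext l i
        exact (hbι j l i).symm
    let SV : Set F := Set.range (fun q : Fin r × Fin n => v q.1 q.2) ∪ Set.range b
    let SS : Set F := Set.range (fun q : Fin d × Fin n => subRows v z q.1 q.2) ∪ Set.range b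
    have hSV := eRk_schubertRows_le k (fun j => (hI j).injective) v (nestedRows I K v z x)
      (nestedRows_mem_span (fun j => (hI j).injective) (fun j => (hK j).injective) v z x)
    have hSS := eRk_schubertRows_le k hinjL (subRows v z) (nestedRows I K v z x)
      (nestedRows_mem_span_sub (fun j => (hI j).injective) (fun j => (hK j).injective) v z x)
    have hsubmod := (AlgebraicIndependent.matroid k F).eRk_submod SV SS
    have hinter : ((s * (n * n) : ℕ) : ℕ∞) ≤
        (AlgebraicIndependent.matroid k F).eRk (SV ∩ SS) := by
      refine le_trans (le_of_eq ?_) (Matroid.eRk_mono _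
        (Set.subset_inter Set.subset_union_right Set.subset_union_right :
          Set.range b ⊆ SV ∩ SS))
      rw [eRk_range_of_algebraicIndependent hb]
      simp
    have hunion : ((r * n + (d * r + ∑ j, ∑ l, if l ∈ Set.range (I j ∘ K j)
        then rowParams (I j ∘ K j) l else rowParams (I j) l) : ℕ) : ℕ∞) ≤
        (AlgebraicIndependent.matroid k F).eRk (SV ∪ SS) := by
      let act : Fin s → Fin n → Set (Fin n) := fun j l => if l ∈ Set.range (I j ∘ K j)
        then {m | l ∈ Set.range (I j ∘ K j) → m ∈ Set.range (I j ∘ K j) ∨ m < l}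
        else {m | l ∈ Set.range (I j) → m ∈ Set.range (I j) ∨ m < l}
      let emb : (Fin r × Fin n) ⊕ (Fin d × Fin r) ⊕ (Σ j : Fin s, Σ l : Fin n, act j l) → σ :=
        Sum.map id (Sum.map id fun q => (q.1, q.2.1, q.2.2))
      have hemb : Function.Injective emb := by
        refine Sum.map_injective.2 ⟨Function.injective_id, Sum.map_injective.2
          ⟨Function.injective_id, ?_⟩⟩
        rintro ⟨j, l, m⟩ ⟨j', l', m'⟩ h
        simp only [Prod.mk.injEq] at h
        obtain ⟨rfl, rfl, h⟩ := h
        rw [Subtype.ext h]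
      have hcard : ∀ j l, Nat.card (act j l) = if l ∈ Set.range (I j ∘ K j)
          then rowParams (I j ∘ K j) l else rowParams (I j) l := by
        intro j l
        by_cases hl : l ∈ Set.range (I j ∘ K j)
        · simp only [act, if_pos hl, rowParams]
          rfl
        · simp only [act, if_neg hl, rowParams]
          rfl
      have hr := eRk_range_of_algebraicIndependent (hg.comp emb hemb)
      have hn : Nat.card ((Fin r × Fin n) ⊕ (Fin d × Fin r) ⊕
          (Σ j : Fin s, Σ l : Fin n, act j l)) =
          r * n + (d * r + ∑ j, ∑ l, if l ∈ Set.range (I j ∘ K j)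
            then rowParams (I j ∘ K j) l else rowParams (I j) l) := by
        simp only [Nat.card_sum, Nat.card_prod, Nat.card_sigma, hcard,
          Nat.card_eq_fintype_card (α := Fin _), Fintype.card_fin]
      rw [← hn, ← hr]
      apply eRk_le_of_subset_adjoin
      obtain ⟨h1, h2, h3⟩ := nestedRows_params_mem (fun j => (hI j).injective)
        (fun j => (hK j).injective) v z x (IntermediateField.adjoin k (SV ∪ SS))
        (fun a i => IntermediateField.subset_adjoin _ _ (Or.inl (Or.inl ⟨(a, i), rfl⟩)))
        (fun t i => IntermediateField.subset_adjoin _ _ (Or.inr (Or.inl ⟨(t, i), rfl⟩)))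
        (fun j l i => IntermediateField.subset_adjoin _ _ (Or.inl (Or.inr ⟨(j, l, i), rfl⟩)))
        hdetV hdetS hs
      rintro _ ⟨(⟨a, i⟩ | ⟨t, a⟩ | ⟨j, l, m, hm⟩), rfl⟩
      · exact IntermediateField.subset_adjoin _ _ (Or.inl (Or.inl ⟨(a, i), rfl⟩))
      · exact h1 t a
      · by_cases hl : l ∈ Set.range (I j ∘ K j)
        · simp only [act, if_pos hl] at hm
          exact h2 j l m hl (hm hl)
        · simp only [act, if_neg hl] at hm
          exact h3 j l m hl hm
    apply daggerZ_nonpos_of_params_le hI hK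
    have := (add_le_add hinter hunion).trans (hsubmod.trans (add_le_add hSV hSS))
    exact_mod_cast this
  · rw [algebraicIndependent_iff] at hb
    push Not at hb
    obtain ⟨f, hf, hf0⟩ := hb
    refine ⟨f, hf0, fun v' z' x' => ?_⟩
    have h1 : MvPolynomial.aeval (fun q : Fin s × Fin n × Fin n =>
        nestedRows I K vR zR xR q.1 q.2.1 q.2.2) f = 0 := by
      apply hι
      rw [map_zero, ← hf, MvPolynomial.comp_aeval_apply]
      congr 2
      funext q
      exact hbι _ _ _
    let φ : R →ₐ[k] k := MvPolynomial.aeval (Sum.elim (fun q => v' q.1 q.2)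
      (Sum.elim (fun q => z' q.1 q.2) (fun q => x' q.1 q.2.1 q.2.2)))
    have hφv : (fun a i => φ (vR a i)) = v' := by
      funext a i
      exact MvPolynomial.aeval_X _ _
    have hφz : (fun t a => φ (zR t a)) = z' := by
      funext t a
      exact MvPolynomial.aeval_X _ _
    have hφx : (fun j l i => φ (xR j l i)) = x' := by
      funext j l i
      exact MvPolynomial.aeval_X _ _
    have hφb : (fun q : Fin s × Fin n × Fin n => φ (nestedRows I K vR zR xR q.1 q.2.1 q.2.2)) =
        fun q => nestedRows I K v' z' x' q.1 q.2.1 q.2.2 := by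
      rw [← hφv, ← hφz, ← hφx]
      funext q
      exact map_nestedRows φ.toRingHom I K vR zR xR q.1 q.2.1 q.2.2
    have h2 := congrArg φ h1
    rwa [map_zero, MvPolynomial.comp_aeval_apply, MvPolynomial.aeval_eq_eval, hφb] at h2

lemma schubertRows_congr {A : Type*} [CommRing A] {n p : ℕ} {P : Fin p → Fin n}
    {w : Fin p → Fin n → A} {c c' u u' : Fin n → Fin n → A} {l : Fin n}
    (hc : l ∈ Set.range P → c l = c' l) (hu : ∀ m, m ∉ Set.range P → u m = u' m) :
    schubertRows P w c u l = schubertRows P w c' u' l := by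
  by_cases hl : l ∈ Set.range P
  · have hext : Function.extend P w u = Function.extend P w u' := by
      funext m
      by_cases hm : ∃ a, P a = m
      · simp only [Function.extend, dif_pos hm]
      · rw [Function.extend_apply' _ _ _ hm, Function.extend_apply' _ _ _ hm, hu m hm]
    rw [schubertRows_of_mem _ _ _ hl, schubertRows_of_mem _ _ _ hl, hc hl, hext]
  · rw [schubertRows_of_notMem _ _ _ hl, schubertRows_of_notMem _ _ _ hl, hu l hl]

lemma exists_eq_nestedRows {F : Type*} [Field F] {n r d s : ℕ} {I : Fin s → Fin r → Fin n}
    {K : Fin s → Fin d → Fin r} (hI : ∀ j, Function.Injective (I j))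
    (hK : ∀ j, Function.Injective (K j)) (v : Fin r → Fin n → F) (z : Fin d → Fin r → F)
    (b : Fin s → Fin n → Fin n → F)
    (hv : ∀ j, ∀ l ∈ Set.range (I j), b j l ∈ span F (Set.range v ∪ b j '' {m | m < l}))
    (hz : ∀ j, ∀ l ∈ Set.range (I j ∘ K j),
      b j l ∈ span F (Set.range (subRows v z) ∪ b j '' {m | m < l})) :
    ∃ x, nestedRows I K v z x = b := by
  classical
  choose c hc using fun j => exists_eq_schubertRows (hI j) v (b j) (hv j)
  choose c' hc' using fun j =>
    exists_eq_schubertRows ((hI j).comp (hK j)) (subRows v z) (b j) (hz j)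
  let x : Fin s → Fin n → Fin n → F := fun j l =>
    if l ∈ Set.range (I j ∘ K j) then c' j l else if l ∈ Set.range (I j) then c j l else b j l
  refine ⟨x, ?_⟩
  funext j l
  have hV : ∀ m, m ∉ Set.range (I j ∘ K j) → schubertRows (I j) v (x j) (x j) m = b j m := by
    intro m hm
    refine (schubertRows_congr (fun h => ?_) fun m' hm' => ?_).trans (congrFun (hc j) m).symm
    · simp only [x, if_neg hm, if_pos h]
    · simp only [x, if_neg (notMem_range_comp hm'), if_neg hm']
  refine (schubertRows_congr (fun h => ?_) hV).trans (congrFun (hc' j) l).symm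
  simp only [x, if_pos h]

section Geometry

variable {k W : Type*} [Field k] [AddCommGroup W] [Module k W] [FiniteDimensional k W]

lemma mem_sup_span_of_cellMem {n p : ℕ} {P : Fin p → Fin n} {b : Fin n → W} {T : Submodule k W}
    (hT : cellMem P (spanFlag k b) T) {l : Fin n} (hl : l ∈ Set.range P) :
    b l ∈ T ⊔ span k (b '' {m | m < l}) := by
  obtain ⟨a, rfl⟩ := hl
  have hE : ∀ m, spanFlag k b m = span k (b '' {i | (i : ℕ) < m}) := fun _ => rfl
  have hlt : finrank k ↥(T ⊓ spanFlag k b (P a)) <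
      finrank k ↥(T ⊓ spanFlag k b ((P a : ℕ) + 1)) := by
    rw [hT.2 _ (P a).2.le, hT.2 _ (P a).2]
    refine Finset.card_lt_card ⟨fun i hi => ?_, fun h => ?_⟩
    · simp only [Finset.mem_filter, Finset.mem_univ, true_and] at hi ⊢
      omega
    · have := h (Finset.mem_filter.2 ⟨Finset.mem_univ a, le_rfl⟩)
      simp only [Finset.mem_filter, Finset.mem_univ, true_and] at this
      omega
  have hnle : ¬ T ⊓ spanFlag k b ((P a : ℕ) + 1) ≤ T ⊓ spanFlag k b (P a) := fun h =>
    absurd (Submodule.finrank_mono h) (not_le.2 hlt)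
  obtain ⟨x, ⟨hxT, hx1⟩, hx0⟩ := SetLike.not_le_iff_exists.1 hnle
  have hins : {i : Fin n | (i : ℕ) < (P a : ℕ) + 1} = insert (P a) {i | i < P a} := by
    ext i
    simp only [Set.mem_ofPred_eq, Set.mem_insert_iff, Fin.ext_iff, Fin.lt_def]
    omega
  rw [SetLike.mem_coe, hE, hins, Set.image_insert_eq, mem_span_insert] at hx1
  obtain ⟨c, y, hy, rfl⟩ := hx1
  have hc : c ≠ 0 := by
    rintro rfl
    exact hx0 ⟨hxT, by rw [zero_smul, zero_add]; exact hy⟩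
  have h : c • b (P a) ∈ T ⊔ span k (b '' {m | m < P a}) := by
    have h' := sub_mem (mem_sup_left (T := span k (b '' {m | m < P a})) hxT)
      (mem_sup_right (S := T) hy)
    rwa [add_sub_cancel_right] at h'
  exact (smul_mem_iff _ hc).1 h

lemma exists_span_range_eq (T : Submodule k W) {p : ℕ} (hT : finrank k T = p) :
    ∃ w : Fin p → W, span k (Set.range w) = T := by
  let B := finBasisOfFinrankEq k T hT
  refine ⟨fun a => B a, ?_⟩
  have : (Set.range fun a => (B a : W)) = T.subtype '' Set.range B := by
    rw [← Set.range_comp]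
    rfl
  rw [this, ← Submodule.map_span, B.span_eq, Submodule.map_top, Submodule.range_subtype]

lemma exists_nestedRows_eq_coordinates {n r d s : ℕ} (e : W ≃ₗ[k] Fin n → k)
    {I : Fin s → Fin r → Fin n} {K : Fin s → Fin d → Fin r} (hI : ∀ j, StrictMono (I j))
    (hK : ∀ j, StrictMono (K j)) {b : Fin s → Fin n → W} {S V : Submodule k W} (hSV : S ≤ V)
    (hV : ∀ j, cellMem (I j) (spanFlag k (b j)) V) (hVr : finrank k V = r)
    (hS : ∀ j, cellMem (I j ∘ K j) (spanFlag k (b j)) S) (hSd : finrank k S = d) :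
    ∃ v z x, nestedRows I K v z x = fun j l => e (b j l) := by
  obtain ⟨v, hv⟩ := exists_span_range_eq V hVr
  obtain ⟨w, hw⟩ := exists_span_range_eq S hSd
  have hwV : ∀ t, w t ∈ span k (Set.range v) := fun t =>
    hv ▸ hSV (hw ▸ subset_span ⟨t, rfl⟩)
  choose z hz using fun t => (mem_span_range_iff_exists_fun k).1 (hwV t)
  have hsub : subRows (fun a => e (v a)) z = fun t => e (w t) := by
    funext t i
    rw [← hz t, map_sum]
    simp [subRows]
  have hmem : ∀ {p : ℕ} (u : Fin p → W) (j : Fin s) (l : Fin n),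
      b j l ∈ span k (Set.range u) ⊔ span k (b j '' {m | m < l}) →
      e (b j l) ∈ span k (Set.range (fun a => e (u a)) ∪ (fun l => e (b j l)) '' {m | m < l}) := by
    intro p u j l h
    rw [← span_union] at h
    have h' := Submodule.mem_map_of_mem (f := e.toLinearMap) h
    rw [Submodule.map_span, Set.image_union, Set.image_image, ← Set.range_comp] at h'
    exact h'
  obtain ⟨x, hx⟩ := exists_eq_nestedRows (fun j => (hI j).injective) (fun j => (hK j).injective)
    (fun a => e (v a)) z (fun j l => e (b j l))
    (fun j l hl => hmem v j l (hv ▸ mem_sup_span_of_cellMem (hV j) hl))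
    (fun j l hl => hsub ▸ hmem w j l (hw ▸ mem_sup_span_of_cellMem (hS j) hl))
  exact ⟨_, z, x, hx⟩

lemma card_filter_strictMono {p q n : ℕ} {I : Fin p → Fin n} (hI : StrictMono I)
    {K : Fin q → Fin p} (u : ℕ) :
    (Finset.univ.filter fun t => (I (K t) : ℕ) + 1 ≤ u).card =
      (Finset.univ.filter fun t =>
        (K t : ℕ) + 1 ≤ (Finset.univ.filter fun a => (I a : ℕ) + 1 ≤ u).card).card := by
  congr 1
  ext t
  simp only [Finset.mem_filter, Finset.mem_univ, true_and]
  constructor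
  · intro h
    have : Finset.Iic (K t) ⊆ Finset.univ.filter fun a => (I a : ℕ) + 1 ≤ u := by
      intro a ha
      have := hI.monotone (Finset.mem_Iic.1 ha)
      simp only [Finset.mem_filter, Finset.mem_univ, true_and]
      omega
    simpa using Finset.card_le_card this
  · intro h
    by_contra hu
    have : (Finset.univ.filter fun a => (I a : ℕ) + 1 ≤ u) ⊆ Finset.Iio (K t) := by
      intro a ha
      simp only [Finset.mem_filter, Finset.mem_univ, true_and] at ha
      exact Finset.mem_Iio.2 (hI.lt_iff_lt.1 (by omega))
    have := Finset.card_le_card this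
    simp only [Fin.card_Iio] at this
    omega

lemma eq_of_card_filter_eq {d n : ℕ} {L M : Fin d → Fin n} (hL : StrictMono L)
    (hM : StrictMono M) (h : ∀ u ≤ n, (Finset.univ.filter fun t => (L t : ℕ) + 1 ≤ u).card =
      (Finset.univ.filter fun t => (M t : ℕ) + 1 ≤ u).card) : L = M := by
  have key : ∀ {L M : Fin d → Fin n}, StrictMono L → StrictMono M →
      (∀ u ≤ n, (Finset.univ.filter fun t => (L t : ℕ) + 1 ≤ u).card =
        (Finset.univ.filter fun t => (M t : ℕ) + 1 ≤ u).card) → ∀ t, M t ≤ L t := by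
    intro L M hL hM h t
    have h1 := card_filter_strictMono hL (K := fun _ : Fin 1 => t) ((L t : ℕ) + 1)
    have h2 := card_filter_strictMono hM (K := fun _ : Fin 1 => t) ((L t : ℕ) + 1)
    rw [← h _ (L t).2, ← h1] at h2
    by_contra hlt
    have h3 : ¬ ((M t : ℕ) + 1 ≤ L t + 1) := by
      rw [not_le, Fin.lt_def] at hlt
      omega
    simp [h3] at h2
  funext t
  exact le_antisymm (key hM hL (fun u hu => (h u hu).symm) t) (key hL hM h t)

lemma indSub_finrank {E : ℕ → Submodule k W} (hE : Monotone E) (V : Submodule k W) (u : ℕ) :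
    indSub E V (finrank k ↥(V ⊓ E u)) = comap V.subtype (E u) := by
  have hfr : ∀ m, finrank k ↥(comap V.subtype (E m)) = finrank k ↥(V ⊓ E m) := fun m =>
    ((comapSubtypeEquivOfLe inf_le_left).symm ≪≫ₗ
      LinearEquiv.ofEq _ _ (by ext; simp)).finrank_eq.symm
  refine le_antisymm (iInf₂_le u (hfr u).ge) (le_iInf₂ fun m hm => ?_)
  rcases le_total u m with h | h
  · exact comap_mono (hE h)
  · refine (eq_of_le_of_finrank_le (comap_mono (hE h)) ?_).ge
    rw [hfr u]
    exact hm

lemma eq_comp_of_cellMem {n r d : ℕ} {E : ℕ → Submodule k W} (hE : Monotone E)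
    {S V : Submodule k W} (hSV : S ≤ V) {I : Fin r → Fin n} (hI : StrictMono I)
    (hV : cellMem I E V) {K : Fin d → Fin r} (hK : StrictMono K)
    (hS : cellMem K (indSub E V) (comap V.subtype S)) {L : Fin d → Fin n} (hL : StrictMono L)
    (hS' : cellMem L E S) : L = I ∘ K := by
  refine eq_of_card_filter_eq hL (hI.comp hK) fun u hu => ?_
  have h1 := hS.2 (finrank k ↥(V ⊓ E u)) (hV.1 ▸ Submodule.finrank_mono inf_le_left)
  rw [indSub_finrank hE, ← comap_inf] at h1
  rw [← hS'.2 u hu]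
  refine Eq.trans ?_ (h1.trans ?_)
  · exact (comapSubtypeEquivOfLe (inf_le_left.trans hSV)).finrank_eq.symm
  · rw [hV.2 u hu]
    exact (card_filter_strictMono hI u).symm

end Geometry

lemma eDimZ_sub_eDimZ_comp {n r d s : ℕ} (I : Fin s → Fin r → Fin n) (K : Fin s → Fin d → Fin r) :
    eDimZ r d K - eDimZ n d (fun j => I j ∘ K j) = daggerZ n r d I K := by
  have h : ∀ j, ∑ t : Fin d, ((n : ℤ) - r + (K j t : ℕ) - (I j (K j t) : ℕ)) =
      ∑ t : Fin d, ((n : ℤ) - d + (t : ℕ) - ((I j ∘ K j) t : ℕ)) -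
        ∑ t : Fin d, ((r : ℤ) - d + (t : ℕ) - (K j t : ℕ)) := by
    intro j
    rw [← Finset.sum_sub_distrib]
    refine Finset.sum_congr rfl fun t _ => ?_
    simp only [Function.comp_apply]
    ring
  unfold eDimZ daggerZ
  rw [Finset.sum_congr rfl fun j _ => h j, Finset.sum_sub_distrib]
  ring

lemma spanFlag_mono (k : Type*) {M : Type*} [Field k] [AddCommGroup M] [Module k M] {r : ℕ}
    (b : Fin r → M) : Monotone (spanFlag k b) := fun _ _ h =>
  span_mono (Set.image_mono fun _ ha => lt_of_lt_of_le ha h)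

/-- A generic tuple of flags satisfies the expected dimension inequality for all nested
positions: the exceptional tuples lie in a single hypersurface. -/
lemma exists_polynomial_forall_daggerZ_nonpos (k : Type*) [Field k] {n s : ℕ} (hs : 0 < s) :
    ∃ f : MvPolynomial (Fin s × Fin n × Fin n) k, f ≠ 0 ∧
      ∀ (r d : ℕ) (I : Fin s → Fin r → Fin n) (K : Fin s → Fin d → Fin r),
        (∀ j, StrictMono (I j)) → (∀ j, StrictMono (K j)) → ∀ v z x,
        MvPolynomial.eval (fun q => nestedRows I K v z x q.1 q.2.1 q.2.2) f ≠ 0 →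
        daggerZ n r d I K ≤ 0 := by
  classical
  have h : ∀ (q : Σ r : Fin (n + 1), Σ d : Fin (n + 1),
      (Fin s → Fin r → Fin n) × (Fin s → Fin d → Fin r)),
      ∃ f : MvPolynomial (Fin s × Fin n × Fin n) k, f ≠ 0 ∧
        ((∀ j, StrictMono (q.2.2.1 j)) → (∀ j, StrictMono (q.2.2.2 j)) → ∀ v z x,
          MvPolynomial.eval (fun p => nestedRows q.2.2.1 q.2.2.2 v z x p.1 p.2.1 p.2.2) f ≠ 0 →
          daggerZ n q.1 q.2.1 q.2.2.1 q.2.2.2 ≤ 0) := by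
    rintro ⟨r, d, I, K⟩
    by_cases hq : (∀ j, StrictMono (I j)) ∧ (∀ j, StrictMono (K j)) ∧ ¬ daggerZ n r d I K ≤ 0
    · obtain ⟨f, hf, hf0⟩ :=
        exists_polynomial_vanishing_on_nestedRows k hs hq.1 hq.2.1 hq.2.2
      exact ⟨f, hf, fun _ _ v z x h => absurd (hf0 v z x) h⟩
    · refine ⟨1, one_ne_zero, fun hI hK _ _ _ _ => ?_⟩
      by_contra hd
      exact hq ⟨hI, hK, hd⟩
  choose f hf hf' using h
  refine ⟨∏ q, f q, Finset.prod_ne_zero_iff.2 fun q _ => hf q, fun r d I K hI hK v z x hne => ?_⟩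
  have hr : r ≤ n := by
    simpa using Fintype.card_le_of_injective _ (hI ⟨0, hs⟩).injective
  have hd : d ≤ r := by
    simpa using Fintype.card_le_of_injective _ (hK ⟨0, hs⟩).injective
  rw [map_prod, Finset.prod_ne_zero_iff] at hne
  exact hf' ⟨⟨r, by omega⟩, ⟨d, by omega⟩, I, K⟩ hI hK v z x (hne _ (Finset.mem_univ _))

lemma exists_eval_ne_zero_and_det_ne_zero {k : Type*} [Field k] [Infinite k] {n s : ℕ}
    {f : MvPolynomial (Fin s × Fin n × Fin n) k} (hf : f ≠ 0) :
    ∃ N : Fin s → Matrix (Fin n) (Fin n) k,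
      MvPolynomial.eval (fun q => N q.1 q.2.1 q.2.2) f ≠ 0 ∧ ∀ j, (N j).det ≠ 0 := by
  let X : Fin s → Matrix (Fin n) (Fin n) (MvPolynomial (Fin s × Fin n × Fin n) k) := fun j =>
    Matrix.of fun l i => MvPolynomial.X (j, l, i)
  have hmap : ∀ (N : Fin s → Matrix (Fin n) (Fin n) k) (j : Fin s),
      MvPolynomial.eval (fun q => N q.1 q.2.1 q.2.2) (X j).det = (N j).det := by
    intro N j
    rw [RingHom.map_det]
    congr 1
    ext l i
    exact MvPolynomial.eval_X _
  have hX : ∀ j, (X j).det ≠ 0 := fun j h => by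
    have := hmap (fun _ => 1) j
    rw [h, map_zero, Matrix.det_one] at this
    exact zero_ne_one this
  have hG : f * ∏ j, (X j).det ≠ 0 :=
    mul_ne_zero hf (Finset.prod_ne_zero_iff.2 fun j _ => hX j)
  obtain ⟨y, hy⟩ : ∃ y, MvPolynomial.eval y (f * ∏ j, (X j).det) ≠ 0 := by
    by_contra! h
    exact hG (MvPolynomial.funext fun y => by rw [h y, map_zero])
  rw [map_mul, map_prod, mul_ne_zero_iff, Finset.prod_ne_zero_iff] at hy
  exact ⟨fun j => Matrix.of fun l i => y (j, l, i), hy.1, fun j =>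
    hmap (fun j => Matrix.of fun l i => y (j, l, i)) j ▸ hy.2 j (Finset.mem_univ j)⟩

/-- Proposition `l2` (2).  For an `n`-dimensional `W` there is a
nonempty Zariski open subset `U` of `Fl(W)^s` such that for `𝓔 ∈ U` and any
`S ⊆ V ⊆ W` (with the unique tuples `𝓘, 𝓚, 𝓛` of subsets as above), one has
`dim(S,V,𝓔(V)) - dim(S,W,𝓔) ≤ 0` and consequently the inequality `(†^𝓘_𝓚) ≤ 0`. -/
theorem stmt7 (k : Type) [Field k] [IsAlgClosed k]
    {W : Type} [AddCommGroup W] [Module k W] [FiniteDimensional k W]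
    (n s : ℕ) (hs : 0 < s) (hW : Module.finrank k W = n) :
    GenericFlags k s n (fun E =>
      ∀ (r d : ℕ) (S V : Submodule k W), S ≤ V →
        Module.finrank k ↥V = r → Module.finrank k ↥S = d →
        ∀ I : Fin s → Fin r → Fin n, (∀ j, StrictMono (I j)) →
          (∀ j, cellMem (I j) (E j) V) →
        ∀ K : Fin s → Fin d → Fin r, (∀ j, StrictMono (K j)) →
          (∀ j, cellMem (K j) (indSub (E j) V) (Submodule.comap V.subtype S)) →
        ∀ L : Fin s → Fin d → Fin n, (∀ j, StrictMono (L j)) →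
          (∀ j, cellMem (L j) (E j) S) →
          eDimZ r d K - eDimZ n d L ≤ 0 ∧ daggerZ n r d I K ≤ 0) := by
  obtain ⟨f, hf, hf'⟩ := exists_polynomial_forall_daggerZ_nonpos k (n := n) hs
  let e : W ≃ₗ[k] Fin n → k := (finBasisOfFinrankEq k W hW).equivFun
  let coord : Fin s × Fin n × Fin n → Dual k (Fin s → Fin n → W) := fun q =>
    LinearMap.proj q.2.2 ∘ₗ e.toLinearMap ∘ₗ LinearMap.proj q.2.1 ∘ₗ LinearMap.proj q.1
  have hcoord : ∀ b : Fin s → Fin n → W, mEval k b (MvPolynomial.rename coord f) =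
      MvPolynomial.eval (fun q => e (b q.1 q.2.1) q.2.2) f := fun b =>
    MvPolynomial.eval_rename _ _ _
  refine ⟨{b | mEval k b (MvPolynomial.rename coord f) ≠ 0},
    TopologicalSpace.GenerateOpen.basic _ ⟨_, rfl⟩, ?_, ?_⟩
  · have : Infinite k := IsAlgClosed.instInfinite
    obtain ⟨N, hN, hdet⟩ := exists_eval_ne_zero_and_det_ne_zero hf
    refine ⟨fun j l => e.symm (N j l), ?_, fun j => ?_⟩
    · rw [Set.mem_ofPred_eq, hcoord]
      simpa only [LinearEquiv.apply_symm_apply] using hN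
    · have h := Matrix.linearIndependent_rows_iff_isUnit.2
        ((Matrix.isUnit_iff_isUnit_det _).2 (hdet j).isUnit)
      exact h.map' e.symm.toLinearMap e.symm.ker
  · intro b hb _ r d S V hSV hVr hSd I hI hV K hK hS L hL hL'
    have hLIK : L = fun j => I j ∘ K j := funext fun j =>
      eq_comp_of_cellMem (spanFlag_mono k (b j)) hSV (hI j) (hV j) (hK j) (hS j) (hL j) (hL' j)
    subst hLIK
    obtain ⟨v, z, x, hx⟩ := exists_nestedRows_eq_coordinates e hI hK hSV hV hVr hL' hSd
    have h : daggerZ n r d I K ≤ 0 := by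
      refine hf' r d I K hI hK v z x ?_
      rw [hx, ← hcoord]
      exact hb
    exact ⟨(eDimZ_sub_eDimZ_comp I K).trans_le h, h⟩

end
end

section
/- Let I={i_1<…<i_r} ⊆ [n] have cardinality r, W an n-dimensional vector space, E_• a complete flag on W, and V ∈ Ω°_I(E_•). Under the canonical identification of the tangent space T(Gr(r,W))_V with Hom(V, W/V), the tangent space at V to the Schubert cell Ω°_I(E_•) equals {φ ∈ Hom(V, W/V) : φ(E_a(V)) ⊆ E_{i_a−a}(W/V) for a=1,…,r}. -/
noncomputable section

open Module Submodule

/-! ### Zariski tangent vectors at the origin, tested on lines -/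

/-- The restriction of a polynomial function to the line spanned by `y`. -/
def lineRestrict {k M : Type*} [Field k] [AddCommGroup M] [Module k M]
    (p : MvPolynomial (Module.Dual k M) k) (y : M) : Polynomial k :=
  MvPolynomial.aeval (fun l : Module.Dual k M => Polynomial.C (l y) * Polynomial.X) p

lemma eval_lineRestrict {k M : Type*} [Field k] [AddCommGroup M] [Module k M]
    (p : MvPolynomial (Module.Dual k M) k) (y : M) (t : k) :
    (lineRestrict p y).eval t = mEval k (t • y) p := by
  induction p using MvPolynomial.induction_on with
  | C a => simp [lineRestrict, mEval]
  | add p q hp hq => simp_all [lineRestrict, mEval]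
  | mul_X p l hp =>
    simp only [lineRestrict, mEval, map_mul, Polynomial.eval_mul, MvPolynomial.aeval_X,
      MvPolynomial.eval_X, map_smul, smul_eq_mul, Polynomial.eval_C, Polynomial.eval_X] at hp ⊢
    rw [hp]
    ring

lemma eval_derivative_lineRestrict_eq_mkDerivation {k M : Type*} [Field k] [AddCommGroup M]
    [Module k M] (p : MvPolynomial (Module.Dual k M) k) (y : M) :
    (Polynomial.derivative (lineRestrict p y)).eval 0 =
      mEval k 0 (MvPolynomial.mkDerivation k
        (fun l : Module.Dual k M => (MvPolynomial.C (l y) : MvPolynomial (Module.Dual k M) k))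
        p) := by
  induction p using MvPolynomial.induction_on with
  | C a => simp [lineRestrict, mEval]
  | add p q hp hq => simp_all [lineRestrict, mEval]
  | mul_X p l hp =>
    have h0 := eval_lineRestrict p y 0
    simp only [lineRestrict, mEval, zero_smul] at h0 hp ⊢
    simp [Derivation.leibniz, h0]

lemma derivation_sum_apply {R A M ι : Type*} [CommSemiring R] [CommSemiring A] [AddCommMonoid M]
    [Algebra R A] [Module A M] [Module R M] (s : Finset ι) (D : ι → Derivation R A M) (a : A) :
    (∑ i ∈ s, D i) a = ∑ i ∈ s, D i a := by
  rw [← Derivation.coeFnAddMonoidHom_apply, map_sum, Finset.sum_apply]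
  rfl

lemma eval_derivative_lineRestrict {k M : Type*} [Field k] [AddCommGroup M] [Module k M]
    (p : MvPolynomial (Module.Dual k M) k) (y : M) :
    letI := Classical.decEq (Module.Dual k M)
    (Polynomial.derivative (lineRestrict p y)).eval 0 =
      (∑ l ∈ p.vars, mEval k (0 : M) (MvPolynomial.pderiv l p) • (l : Module.Dual k M)) y := by
  classical
  rw [eval_derivative_lineRestrict_eq_mkDerivation]
  have h : MvPolynomial.mkDerivation k
      (fun l : Module.Dual k M => (MvPolynomial.C (l y) : MvPolynomial (Module.Dual k M) k)) p =
      (∑ l ∈ p.vars, (MvPolynomial.C (l y) : MvPolynomial (Module.Dual k M) k) •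
        MvPolynomial.pderiv l : Derivation k _ _) p := by
    apply MvPolynomial.derivation_eq_of_forall_mem_vars
    intro i hi
    rw [derivation_sum_apply, Finset.sum_eq_single i]
    · simp
    · intro j _ hj
      simp [MvPolynomial.pderiv_X_of_ne hj.symm]
    · exact fun h => absurd hi h
  rw [h, derivation_sum_apply, LinearMap.sum_apply]
  simp only [mEval, map_sum]
  refine Finset.sum_congr rfl fun l _ => ?_
  simp [mul_comm]

lemma mem_mTangent_zero {k M : Type*} [Field k] [AddCommGroup M] [Module k M]
    {A : Set M} {y : M} :
    y ∈ mTangent k A 0 ↔ ∀ p : MvPolynomial (Module.Dual k M) k,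
      (∀ a ∈ A, mEval k a p = 0) → (Polynomial.derivative (lineRestrict p y)).eval 0 = 0 := by
  simp only [mTangent, Submodule.mem_iInf, Set.mem_ofPred_eq, LinearMap.mem_ker,
    eval_derivative_lineRestrict]

/-- A vector is tangent to `A` at the origin as soon as the line it spans lies in `A` outside
the zeros of a nonzero polynomial. -/
lemma mem_mTangent_zero_of_line {k M : Type*} [Field k] [Infinite k] [AddCommGroup M]
    [Module k M] {A : Set M} {y : M} (d : Polynomial k) (hd : d ≠ 0)
    (h : ∀ t : k, d.eval t ≠ 0 → t • y ∈ A) : y ∈ mTangent k A 0 := by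
  rw [mem_mTangent_zero]
  intro p hp
  have h0 : d * lineRestrict p y = 0 := by
    apply Polynomial.funext
    intro t
    rw [Polynomial.eval_mul, eval_lineRestrict, Polynomial.eval_zero]
    by_cases ht : d.eval t = 0
    · rw [ht, zero_mul]
    · rw [hp _ (h t ht), mul_zero]
  rw [(mul_eq_zero.mp h0).resolve_left hd]
  simp

/-! ### Differentiating a determinant at a corank one matrix -/

lemma det_one_add_vecMulVec_eq {k ι : Type*} [CommRing k] [Fintype ι] [DecidableEq ι]
    (u w : ι → k) : (1 + Matrix.vecMulVec u w).det = 1 + w ⬝ᵥ u := by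
  rw [Matrix.vecMulVec_eq Unit, Matrix.det_one_add_replicateCol_mul_replicateRow]

lemma det_one_sub_vecMulVec_add_smul {k ι : Type*} [CommRing k] [Fintype ι] [DecidableEq ι]
    (u w : ι → k) (hw : w ⬝ᵥ u = 1) (B : Matrix ι ι k) (t : k) :
    (1 - Matrix.vecMulVec u w + t • B).det =
      t * (1 - Matrix.vecMulVec u w + Matrix.vecMulVec u w * B +
        t • ((1 - Matrix.vecMulVec u w) * B)).det := by
  have he : Matrix.vecMulVec u w * Matrix.vecMulVec u w = Matrix.vecMulVec u w := by
    rw [Matrix.vecMulVec_mul_vecMulVec, hw]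
    simp
  have ht : (1 + Matrix.vecMulVec ((t - 1) • u) w).det = t := by
    rw [det_one_add_vecMulVec_eq, dotProduct_smul, hw]
    simp
  nth_rewrite 2 [← ht]
  rw [← Matrix.det_mul]
  congr 1
  rw [Matrix.smul_vecMulVec]
  generalize Matrix.vecMulVec u w = e at he
  have h1 : e * (e * B) = e * B := by rw [← mul_assoc, he]
  simp only [mul_add, add_mul, mul_sub, sub_mul, one_mul, mul_one, smul_mul_assoc,
    mul_smul_comm, he, h1]
  module

lemma eval_derivative_of_eval_eq_det {k ι : Type*} [Field k] [Infinite k] [Fintype ι]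
    [DecidableEq ι] (u w : ι → k) (hw : w ⬝ᵥ u = 1) (B : Matrix ι ι k) (q : Polynomial k)
    (hq : ∀ t, q.eval t = (1 - Matrix.vecMulVec u w + t • B).det) :
    (Polynomial.derivative q).eval 0 = w ⬝ᵥ B.mulVec u := by
  set e := Matrix.vecMulVec u w with he
  let H : Polynomial k := ((1 - e + e * B).map Polynomial.C +
    (Polynomial.X : Polynomial k) • ((1 - e) * B).map Polynomial.C).det
  have hH : ∀ t, H.eval t = (1 - e + e * B + t • ((1 - e) * B)).det := by
    intro t
    rw [show H.eval t = Polynomial.evalRingHom t H from rfl, RingHom.map_det]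
    congr 1
    ext i j
    simp [-Matrix.map_mul, mul_comm t]
  have hqH : q = Polynomial.X * H := by
    apply Polynomial.funext
    intro t
    rw [hq, Polynomial.eval_mul, hH, Polynomial.eval_X, det_one_sub_vecMulVec_add_smul u w hw]
  have h0 : 1 - e + e * B = 1 + Matrix.vecMulVec u (Matrix.vecMul w B - w) := by
    rw [Matrix.vecMulVec_sub, ← Matrix.vecMulVec_mul, ← he]
    abel
  rw [hqH, Polynomial.derivative_mul, Polynomial.derivative_X]
  simp [hH, h0, det_one_add_vecMulVec_eq, hw, Matrix.dotProduct_mulVec]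

lemma exists_mEval_eq_det {k M V : Type*} [Field k] [AddCommGroup M] [Module k M]
    [AddCommGroup V] [Module k V] [FiniteDimensional k V] (N : V →ₗ[k] V)
    (L : M →ₗ[k] V →ₗ[k] V) :
    ∃ p : MvPolynomial (Module.Dual k M) k, ∀ x, mEval k x p = LinearMap.det (N + L x) := by
  let b := Module.finBasis k V
  refine ⟨(Matrix.of fun i j => MvPolynomial.C (LinearMap.toMatrix b b N i j) +
    MvPolynomial.X ((b.coord i) ∘ₗ (LinearMap.applyₗ (b j)) ∘ₗ L)).det, fun x => ?_⟩
  rw [← LinearMap.det_toMatrix b, mEval, RingHom.map_det]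
  congr 1
  ext i j
  simp [LinearMap.toMatrix_apply]

lemma apply_eq_zero_of_mem_mTangent {k M V : Type*} [Field k] [Infinite k] [AddCommGroup M]
    [Module k M] [AddCommGroup V] [Module k V] [FiniteDimensional k V] {A : Set M}
    (L : M →ₗ[k] V →ₗ[k] V) (v : V) (f : Module.Dual k V) (hf : f v = 1)
    (hA : ∀ x ∈ A, LinearMap.det (1 - f.smulRight v + L x) = 0) {y : M}
    (hy : y ∈ mTangent k A 0) : f (L y v) = 0 := by
  obtain ⟨p, hp⟩ := exists_mEval_eq_det (1 - f.smulRight v) L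
  let b := Module.finBasis k V
  have hdot : ∀ x, (fun j => f (b j)) ⬝ᵥ ⇑(b.repr x) = f x := fun x => by
    conv_rhs => rw [← b.sum_repr x, map_sum]
    simp only [map_smul, smul_eq_mul, dotProduct, mul_comm]
  have hN : LinearMap.toMatrix b b (1 - f.smulRight v) =
      1 - Matrix.vecMulVec (⇑(b.repr v)) (fun j => f (b j)) := by
    rw [map_sub, LinearMap.toMatrix_one]
    congr 1
    ext i j
    simp [LinearMap.toMatrix_apply, Matrix.vecMulVec_apply, mul_comm]
  have h := eval_derivative_of_eval_eq_det (⇑(b.repr v)) (fun j => f (b j)) ((hdot v).trans hf)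
    (LinearMap.toMatrix b b (L y)) (lineRestrict p y) fun t => by
      rw [eval_lineRestrict, hp, ← LinearMap.det_toMatrix b, map_add, hN, map_smul, map_smul]
  rw [mem_mTangent_zero.mp hy p fun a ha => by rw [hp, hA a ha],
    LinearMap.toMatrix_mulVec_repr, hdot] at h
  exact h.symm

/-! ### Equations of the tangent space -/

lemma exists_extend_vanishing {k W U : Type*} [Field k] [AddCommGroup W] [Module k W]
    [AddCommGroup U] [Module k U] {V E : Submodule k W} (g : V →ₗ[k] U)
    (hg : ∀ v : V, (v : W) ∈ E → g v = 0) :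
    ∃ G : W →ₗ[k] U, (∀ v : V, G v = g v) ∧ ∀ x ∈ E, G x = 0 := by
  let T : V →ₗ[k] W ⧸ E := E.mkQ ∘ₗ V.subtype
  have hT : LinearMap.ker T ≤ LinearMap.ker g := fun v hv => hg v (by simpa [T] using hv)
  obtain ⟨h, hh⟩ := LinearMap.exists_extend
    ((LinearMap.ker T).liftQ g hT ∘ₗ T.quotKerEquivRange.symm.toLinearMap)
  refine ⟨h ∘ₗ E.mkQ, fun v => ?_, fun x hx => ?_⟩
  · have := LinearMap.congr_fun hh (T.quotKerEquivRange ((LinearMap.ker T).mkQ v))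
    simpa [T] using this
  · have : E.mkQ x = 0 := by simpa using hx
    rw [LinearMap.comp_apply, this, map_zero]

lemma graphMap_injective {k W : Type*} [Field k] [AddCommGroup W] [Module k W]
    {V C : Submodule k W} (hC : Disjoint V C) (ψ : V →ₗ[k] C) :
    Function.Injective (V.subtype + C.subtype ∘ₗ ψ) := by
  rw [← LinearMap.ker_eq_bot, LinearMap.ker_eq_bot']
  intro v hv
  have h : (v : W) = -(ψ v : W) := eq_neg_of_add_eq_zero_left (by simpa using hv)
  exact Subtype.ext (Submodule.disjoint_def.mp hC v v.2 (h ▸ C.neg_mem (ψ v).2))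

lemma finrank_comap_eq_graphMap_inf {k W : Type*} [Field k] [AddCommGroup W] [Module k W]
    {V C : Submodule k W} (hC : Disjoint V C) (ψ : V →ₗ[k] C) (E : Submodule k W) :
    finrank k (Submodule.comap (V.subtype + C.subtype ∘ₗ ψ) E) =
      finrank k ↥(graphMap V C ψ ⊓ E) := by
  rw [graphMap, ← Submodule.map_comap_eq]
  exact (Submodule.equivMapOfInjective _ (graphMap_injective hC ψ) _).finrank_eq

lemma finrank_comap_subtype_eq {k W : Type*} [Field k] [AddCommGroup W] [Module k W]
    (V E : Submodule k W) :
    finrank k (Submodule.comap V.subtype E) = finrank k ↥(V ⊓ E) := by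
  rw [← Submodule.map_comap_subtype, Submodule.finrank_map_subtype_eq]

/-- If the graphs of the maps in `A` meet `E` in dimension at least `dim (V ∩ E)`, then tangent
vectors to `A` at the origin send `V ∩ E` into `E + V`. -/
lemma apply_mem_sup_of_mem_mTangent {k W : Type*} [Field k] [Infinite k] [AddCommGroup W]
    [Module k W] [FiniteDimensional k W] {V C E : Submodule k W} (hC : Disjoint V C)
    {A : Set (V →ₗ[k] C)}
    (hA : ∀ ψ ∈ A, finrank k ↥(V ⊓ E) ≤ finrank k ↥(graphMap V C ψ ⊓ E))
    {ψ : V →ₗ[k] C} (hψ : ψ ∈ mTangent k A 0) {v : V} (hv : (v : W) ∈ E) :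
    (ψ v : W) ∈ E ⊔ V := by
  by_contra hnot
  obtain ⟨ℓ, hℓ, hker⟩ := Submodule.exists_le_ker_of_notMem hnot
  have hℓE : ∀ x ∈ E, ℓ x = 0 := fun x hx => hker (le_sup_left (a := E) hx)
  have hℓV : ∀ x ∈ V, ℓ x = 0 := fun x hx => hker (le_sup_right (a := E) hx)
  have hv0 : v ≠ 0 := by
    rintro rfl
    simp at hℓ
  let F := Submodule.comap V.subtype E
  obtain ⟨g, hg⟩ := LinearMap.exists_extend (LinearMap.id : F →ₗ[k] F)
  let π : V →ₗ[k] V := F.subtype ∘ₗ g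
  have hπF : ∀ x, π x ∈ F := fun x => (g x).2
  have hπ : ∀ x ∈ F, π x = x := fun x hx =>
    congrArg Subtype.val (LinearMap.congr_fun hg ⟨x, hx⟩)
  obtain ⟨f₀, hf₀⟩ := Module.Projective.exists_dual_eq_one k hv0
  let f : Module.Dual k V := f₀ ∘ₗ π
  have hfv : f v = 1 := by simp [f, hπ v hv, hf₀]
  have hfπ : ∀ x, f (π x) = f x := fun x => by simp [f, hπ _ (hπF x)]
  obtain ⟨G₀, hG₀V, hG₀E⟩ := exists_extend_vanishing (E := E) (LinearMap.id - π)
    fun x hx => by simp [hπ x hx]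
  let G : W →ₗ[k] V := (LinearMap.id - π) ∘ₗ G₀ + ℓ.smulRight v
  have hfG : ∀ x, f (G x) = ℓ x := fun x => by simp [G, hfπ, hfv]
  have hGE : ∀ x ∈ E, G x = 0 := fun x hx => by simp [G, hG₀E x hx, hℓE x hx]
  have hGV : ∀ x : V, G x = x - π x := fun x => by
    simp [G, hG₀V, hℓV x x.2, hπ _ (hπF x)]
  let L : (V →ₗ[k] C) →ₗ[k] V →ₗ[k] V := LinearMap.llcomp k V C V (G ∘ₗ C.subtype)
  have hL : ∀ χ x, L χ x = G (χ x) := fun _ _ => rfl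
  refine hℓ ?_
  rw [← hfG, ← hL]
  refine apply_eq_zero_of_mem_mTangent L v f hfv (fun χ hχ => ?_) hψ
  let K := Submodule.comap (V.subtype + C.subtype ∘ₗ χ) E
  let F₁ := F ⊓ LinearMap.ker f
  have hF₁ : finrank k F₁ < finrank k K := by
    refine lt_of_lt_of_le (Submodule.finrank_lt_finrank_of_lt (t := F) ?_) ?_
    · refine lt_of_le_of_ne inf_le_left fun h => ?_
      have : v ∈ F₁ := h ▸ hv
      simpa [hfv] using this.2
    · rw [finrank_comap_subtype_eq, finrank_comap_eq_graphMap_inf hC]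
      exact hA χ hχ
  let P : K →ₗ[k] F₁ := LinearMap.codRestrict F₁ ((π - f.smulRight v) ∘ₗ K.subtype) fun x =>
    ⟨F.sub_mem (hπF x) (F.smul_mem _ hv), by simp [hfπ, hfv]⟩
  obtain ⟨z, hz, hz0⟩ := Submodule.exists_mem_ne_zero_of_ne_bot
    (LinearMap.ker_ne_bot_of_finrank_lt (f := P) hF₁)
  have hPz : π z - f z • v = 0 := congrArg Subtype.val hz
  have hzE : (z : V) + (χ z : W) ∈ E := z.2
  by_contra hdet
  have hbot := (LinearMap.isUnit_iff_ker_eq_bot _).mp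
    ((LinearMap.isUnit_iff_isUnit_det _).mpr (isUnit_iff_ne_zero.mpr hdet))
  refine hz0 (Subtype.ext (LinearMap.ker_eq_bot'.mp hbot z ?_))
  have h := hGE _ hzE
  rw [map_add, hGV] at h
  calc (1 - f.smulRight v + L χ) z = (π z - f z • v) + (z - π z + G (χ z)) := by
        simp [hL]; abel
    _ = 0 := by rw [hPz, h, add_zero]

/-! ### Lines inside a Schubert cell -/

lemma map_eq_of_injective_of_mapsTo {k W : Type*} [Field k] [AddCommGroup W] [Module k W]
    [FiniteDimensional k W] {g : W →ₗ[k] W} (hg : Function.Injective g) {E : Submodule k W}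
    (hE : ∀ x ∈ E, g x ∈ E) : Submodule.map g E = E :=
  Submodule.eq_of_le_of_finrank_le (Submodule.map_le_iff_le_comap.mpr hE)
    (Submodule.equivMapOfInjective g hg E).finrank_eq.le

lemma cellMem_map {k W : Type*} [Field k] [AddCommGroup W] [Module k W] {n r : ℕ}
    [FiniteDimensional k W] {I : Fin r → Fin n} {E : ℕ → Submodule k W} {V : Submodule k W}
    (hV : cellMem I E V) {g : W →ₗ[k] W} (hg : Function.Injective g)
    (hE : ∀ u, ∀ x ∈ E u, g x ∈ E u) : cellMem I E (Submodule.map g V) := by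
  refine ⟨?_, fun u hu => ?_⟩
  · rw [← (Submodule.equivMapOfInjective g hg V).finrank_eq, hV.1]
  · rw [← map_eq_of_injective_of_mapsTo hg (hE u), ← Submodule.map_inf g hg,
      ← (Submodule.equivMapOfInjective g hg _).finrank_eq, hV.2 u hu]

/-- Applying `1 + t f ⊗ x` to `V` gives a point of the line spanned by `f|_V ⊗ c` in the chart
around `V`, where `c` is the component of `x = v + c` in the complement. -/
lemma graphMap_smul_smulRight {k W : Type*} [Field k] [AddCommGroup W] [Module k W]
    {V C : Submodule k W} (f : Module.Dual k W) (v : V) (c : C) (t : k)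
    (ht : 1 - t * f v ≠ 0) :
    graphMap V C (t • (f ∘ₗ V.subtype).smulRight c) =
      Submodule.map (LinearMap.id + (t / (1 - t * f v)) • f.smulRight ((v : W) + c)) V := by
  ext y
  simp only [graphMap, LinearMap.mem_range, Submodule.mem_map]
  constructor
  · rintro ⟨w, rfl⟩
    refine ⟨w - (t * f w) • (v : W), V.sub_mem w.2 (V.smul_mem _ v.2), ?_⟩
    have h : t / (1 - t * f v) * f ((w : W) - (t * f w) • (v : W)) = t * f w := by
      rw [map_sub, map_smul, smul_eq_mul]
      field_simp
    change (w : W) - (t * f w) • (v : W) + (t / (1 - t * f v)) •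
      f ((w : W) - (t * f w) • (v : W)) • ((v : W) + c) = (w : W) + t • f w • (c : W)
    rw [smul_smul, h]
    module
  · rintro ⟨w, hw, rfl⟩
    refine ⟨⟨w, hw⟩ + (t / (1 - t * f v) * f w) • v, ?_⟩
    have h : t * f (w + (t / (1 - t * f v) * f w) • (v : W)) = t / (1 - t * f v) * f w := by
      rw [map_add, map_smul, smul_eq_mul]
      field_simp
      ring
    change w + (t / (1 - t * f v) * f w) • (v : W) +
      t • f (w + (t / (1 - t * f v) * f w) • (v : W)) • (c : W) =
      w + (t / (1 - t * f v)) • f w • ((v : W) + c)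
    rw [smul_smul, h]
    module

lemma smulRight_mem_mTangent {k W : Type*} [Field k] [Infinite k] [AddCommGroup W]
    [Module k W] [FiniteDimensional k W] {n r : ℕ} {I : Fin r → Fin n}
    {E : ℕ → Submodule k W} (hE : Monotone E) {V C : Submodule k W} (hV : cellMem I E V)
    {u : ℕ} (f : Module.Dual k W) (hf : ∀ x ∈ E u, f x = 0) (v : V) (c : C)
    (hx : (v : W) + c ∈ E (u + 1)) :
    (f ∘ₗ V.subtype).smulRight c ∈
      mTangent k {ψ : V →ₗ[k] C | cellMem I E (graphMap V C ψ)} 0 := by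
  have hd : ∀ a : k, (1 + Polynomial.C a * Polynomial.X : Polynomial k) ≠ 0 := fun a h => by
    simpa using congrArg (Polynomial.eval 0) h
  refine mem_mTangent_zero_of_line _ (mul_ne_zero (hd (-f v)) (hd (f c))) fun t ht => ?_
  simp only [Polynomial.eval_mul, Polynomial.eval_add, Polynomial.eval_one, Polynomial.eval_C,
    Polynomial.eval_X, mul_ne_zero_iff] at ht
  have h1 : 1 - t * f v ≠ 0 := by
    convert ht.1 using 1
    ring
  have h2 : 1 + t / (1 - t * f v) * f ((v : W) + c) ≠ 0 := by
    have : 1 + t / (1 - t * f v) * f ((v : W) + c) = (1 + f c * t) / (1 - t * f v) := by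
      rw [map_add]
      field_simp
      ring
    rw [this]
    exact div_ne_zero ht.2 h1
  rw [Set.mem_ofPred_eq, graphMap_smul_smulRight f v c t h1]
  refine cellMem_map hV ?_ fun m x hxm => ?_
  · rw [← LinearMap.ker_eq_bot, LinearMap.ker_eq_bot']
    intro x hx0
    simp only [LinearMap.add_apply, LinearMap.id_apply, LinearMap.smul_apply,
      LinearMap.smulRight_apply] at hx0
    have hfx : f x * (1 + t / (1 - t * f v) * f ((v : W) + c)) = 0 := by
      have := congrArg f hx0
      simp only [map_add, map_smul, smul_eq_mul, map_zero] at this ⊢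
      rw [← this]
      ring
    rw [(mul_eq_zero.mp hfx).resolve_right h2] at hx0
    simpa using hx0
  · refine (E m).add_mem hxm ((E m).smul_mem _ ?_)
    rw [LinearMap.smulRight_apply]
    rcases le_or_gt m u with hm | hm
    · rw [hf x (hE hm hxm), zero_smul]
      exact (E m).zero_mem
    · exact (E m).smul_mem _ (hE hm hx)

lemma mem_mTangent_of_forall_apply_mem {k W : Type*} [Field k] [Infinite k] [AddCommGroup W]
    [Module k W] [FiniteDimensional k W] {n r : ℕ} (hW : finrank k W = n)
    {I : Fin r → Fin n} {E : ℕ → Submodule k W} (hE : IsFlag E) {V C : Submodule k W}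
    (hV : cellMem I E V) (ψ : V →ₗ[k] C)
    (hψ : ∀ u ≤ n, ∀ v : V, (v : W) ∈ E u → (ψ v : W) ∈ E u ⊔ V) :
    ψ ∈ mTangent k {ψ : V →ₗ[k] C | cellMem I E (graphMap V C ψ)} 0 := by
  suffices H : ∀ d u, u + d = n → ∀ ψ : V →ₗ[k] C,
      (∀ u ≤ n, ∀ v : V, (v : W) ∈ E u → (ψ v : W) ∈ E u ⊔ V) →
      (∀ v : V, (v : W) ∈ E u → ψ v = 0) →
      ψ ∈ mTangent k {ψ : V →ₗ[k] C | cellMem I E (graphMap V C ψ)} 0 by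
    refine H n 0 (zero_add n) ψ hψ fun v hv => ?_
    have h0 : E 0 = ⊥ := Submodule.finrank_eq_zero.mp (by simp [hE.2])
    have hv0 : v = 0 := Subtype.ext (by simpa [h0] using hv)
    rw [hv0, map_zero]
  intro d
  induction d with
  | zero =>
    intro u hu ψ _ h0
    have htop : E u = ⊤ := Submodule.eq_top_of_finrank_eq (by rw [hE.2]; omega)
    have : ψ = 0 := LinearMap.ext fun v => h0 v (by simp [htop])
    rw [this]
    exact Submodule.zero_mem _
  | succ d ih =>
    intro u hu ψ hψ h0
    by_cases hF : ∀ v : V, (v : W) ∈ E (u + 1) → (v : W) ∈ E u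
    · exact ih (u + 1) (by omega) ψ hψ fun v hv => h0 v (hF v hv)
    push Not at hF
    obtain ⟨v, hv, hvu⟩ := hF
    obtain ⟨f₀, hf₀v, hf₀⟩ := Submodule.exists_le_ker_of_notMem hvu
    let f : Module.Dual k W := (f₀ v)⁻¹ • f₀
    have hfv : f v = 1 := by simp [f, hf₀v]
    have hf : ∀ x ∈ E u, f x = 0 := fun x hx => by
      have : f₀ x = 0 := hf₀ hx
      simp [f, this]
    have hker : E u = E (u + 1) ⊓ LinearMap.ker f := by
      refine Submodule.eq_of_le_of_finrank_le (le_inf (hE.1 u.le_succ) hf) ?_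
      have hlt : E (u + 1) ⊓ LinearMap.ker f < E (u + 1) := by
        refine lt_of_le_of_ne inf_le_left fun h => ?_
        have hmem : (v : W) ∈ E (u + 1) ⊓ LinearMap.ker f := h.symm ▸ hv
        have hfv0 : f v = 0 := hmem.2
        exact one_ne_zero (hfv.symm.trans hfv0)
      have := Submodule.finrank_lt_finrank_of_lt hlt
      rw [hE.2] at this ⊢
      omega
    obtain ⟨x, hx, y, hy, hxy⟩ := Submodule.mem_sup.mp (hψ (u + 1) (by omega) v hv)
    have hx' : ((-⟨y, hy⟩ : V) : W) + ψ v = x := by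
      rw [← hxy]
      simp
    have hmem := smulRight_mem_mTangent hE.1 hV f hf (-⟨y, hy⟩) (ψ v) (hx'.symm ▸ hx)
    rw [← sub_add_cancel ψ ((f ∘ₗ V.subtype).smulRight (ψ v))]
    refine Submodule.add_mem _ (ih (u + 1) (by omega) _ (fun m hm w hw => ?_) fun w hw => ?_) hmem
    · have hsub : (((ψ - (f ∘ₗ V.subtype).smulRight (ψ v)) w : C) : W) =
          ψ w - f w • (ψ v : W) := rfl
      rw [hsub]
      refine Submodule.sub_mem _ (hψ m hm w hw) ?_
      rcases le_or_gt m u with hmu | hmu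
      · rw [hf _ (hE.1 hmu hw), zero_smul]
        exact Submodule.zero_mem _
      · exact Submodule.smul_mem _ _ (sup_le_sup_right (hE.1 hmu) V (hψ (u + 1) (by omega) v hv))
    · have hz : ((w - f w • v : V) : W) ∈ E u := by
        rw [hker]
        refine ⟨(E (u + 1)).sub_mem hw ((E (u + 1)).smul_mem _ hv), ?_⟩
        simp [hfv]
      have := h0 _ hz
      rw [map_sub, map_smul] at this
      exact this

/-! ### The induced flags -/

lemma card_filter_succ_le {n r : ℕ} {I : Fin r → Fin n} (hI : StrictMono I) (a : Fin r) :
    (Finset.univ.filter fun b : Fin r => (I b : ℕ) + 1 ≤ (I a : ℕ) + 1).card = (a : ℕ) + 1 := by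
  rw [← Fin.card_Iic a]
  refine congrArg Finset.card (Finset.ext fun b => ?_)
  simp [hI.le_iff_le]

lemma indSub_succ_eq {k W : Type*} [Field k] [AddCommGroup W] [Module k W] {n r : ℕ}
    {I : Fin r → Fin n} (hI : StrictMono I) {E : ℕ → Submodule k W} (hE : Monotone E)
    {V : Submodule k W} (hV : cellMem I E V) (a : Fin r) :
    indSub E V ((a : ℕ) + 1) = Submodule.comap V.subtype (E ((I a : ℕ) + 1)) := by
  refine le_antisymm (iInf₂_le _ ?_) (le_iInf₂ fun u hu => ?_)
  · rw [Set.mem_ofPred_eq, finrank_comap_subtype_eq, hV.2 _ (I a).2, card_filter_succ_le hI]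
  · rw [Set.mem_ofPred_eq, finrank_comap_subtype_eq] at hu
    refine Submodule.comap_mono (hE ?_)
    by_contra! h
    have hsub : (Finset.univ.filter fun b : Fin r => (I b : ℕ) + 1 ≤ u) ⊆ Finset.Iio a := by
      intro b hb
      rw [Finset.mem_filter] at hb
      rw [Finset.mem_Iio, ← hI.lt_iff_lt, Fin.lt_def]
      omega
    have hcard := Finset.card_le_card hsub
    rw [Fin.card_Iio, ← hV.2 u (by omega)] at hcard
    omega

lemma finrank_map_mkQ_add_finrank_inf {k W : Type*} [Field k] [AddCommGroup W] [Module k W]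
    [FiniteDimensional k W] (V E : Submodule k W) :
    finrank k (Submodule.map V.mkQ E) + finrank k ↥(V ⊓ E) = finrank k E := by
  have h := LinearMap.finrank_range_add_finrank_ker (V.mkQ ∘ₗ E.subtype)
  rwa [LinearMap.range_comp, Submodule.range_subtype, LinearMap.ker_comp, Submodule.ker_mkQ,
    finrank_comap_subtype_eq, inf_comm] at h

lemma indQuot_sub_eq {k W : Type*} [Field k] [AddCommGroup W] [Module k W]
    [FiniteDimensional k W] {n r : ℕ} (hW : finrank k W = n) {I : Fin r → Fin n}
    (hI : StrictMono I) {E : ℕ → Submodule k W} (hE : IsFlag E) {V : Submodule k W}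
    (hV : cellMem I E V) (a : Fin r) :
    indQuot E V ((I a : ℕ) - (a : ℕ)) = Submodule.map V.mkQ (E ((I a : ℕ) + 1)) := by
  have hdim : finrank k (Submodule.map V.mkQ (E ((I a : ℕ) + 1))) = (I a : ℕ) - (a : ℕ) := by
    have h := finrank_map_mkQ_add_finrank_inf V (E ((I a : ℕ) + 1))
    rw [hV.2 _ (I a).2, card_filter_succ_le hI, hE.2] at h
    have := (I a).2
    omega
  refine le_antisymm (iInf₂_le _ ?_) (le_iInf₂ fun u hu => ?_)
  · rw [Set.mem_ofPred_eq, hdim]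
  rcases le_total ((I a : ℕ) + 1) u with h | h
  · exact Submodule.map_mono (hE.1 h)
  · have hu' : (I a : ℕ) - (a : ℕ) ≤ finrank k (Submodule.map V.mkQ (E u)) := hu
    rw [← hdim] at hu'
    have hle : Submodule.map V.mkQ (E u) ≤ Submodule.map V.mkQ (E ((I a : ℕ) + 1)) :=
      Submodule.map_mono (hE.1 h)
    exact (Submodule.eq_of_le_of_finrank_le hle hu').ge

lemma exists_inf_eq_of_cellMem {k W : Type*} [Field k] [AddCommGroup W] [Module k W]
    [FiniteDimensional k W] {n r : ℕ} {I : Fin r → Fin n} (hI : StrictMono I)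
    {E : ℕ → Submodule k W} (hE : Monotone E) {V : Submodule k W} (hV : cellMem I E V)
    {u : ℕ} (hu : u ≤ n) (hne : V ⊓ E u ≠ ⊥) :
    ∃ a : Fin r, (I a : ℕ) + 1 ≤ u ∧ V ⊓ E ((I a : ℕ) + 1) = V ⊓ E u := by
  have hs : (Finset.univ.filter fun b : Fin r => (I b : ℕ) + 1 ≤ u).Nonempty := by
    rw [← Finset.card_ne_zero, ← hV.2 u hu]
    exact fun h => hne (Submodule.finrank_eq_zero.mp h)
  obtain ⟨a, ha, hmax⟩ := Finset.exists_max_image _ id hs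
  rw [Finset.mem_filter] at ha
  refine ⟨a, ha.2, Submodule.eq_of_le_of_finrank_le (inf_le_inf_left V (hE ha.2)) ?_⟩
  rw [hV.2 u hu, hV.2 _ (I a).2]
  refine Finset.card_le_card fun b hb => ?_
  have hba : I b ≤ I a := hI.monotone (hmax b hb)
  simpa using hba

lemma forall_map_indSub_le_iff {k W : Type*} [Field k] [AddCommGroup W] [Module k W]
    [FiniteDimensional k W] {n r : ℕ} (hW : finrank k W = n) {I : Fin r → Fin n}
    (hI : StrictMono I) {E : ℕ → Submodule k W} (hE : IsFlag E) {V : Submodule k W}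
    (hV : cellMem I E V) (φ : V →ₗ[k] W ⧸ V) :
    (∀ a : Fin r,
      Submodule.map φ (indSub E V ((a : ℕ) + 1)) ≤ indQuot E V ((I a : ℕ) - (a : ℕ))) ↔
    ∀ u ≤ n, ∀ v : V, (v : W) ∈ E u → φ v ∈ Submodule.map V.mkQ (E u) := by
  constructor
  · intro h u hu v hv
    by_cases hv0 : v = 0
    · rw [hv0, map_zero]
      exact Submodule.zero_mem _
    obtain ⟨a, hau, ha⟩ := exists_inf_eq_of_cellMem hI hE.1 hV hu fun hbot => hv0 <|
      Subtype.ext <| (Submodule.mem_bot k).mp (hbot ▸ ⟨v.2, hv⟩)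
    have hmem : (v : W) ∈ V ⊓ E ((I a : ℕ) + 1) := ha ▸ ⟨v.2, hv⟩
    have h' := h a
    rw [indSub_succ_eq hI hE.1 hV, indQuot_sub_eq hW hI hE hV] at h'
    exact Submodule.map_mono (hE.1 hau) (h' (Submodule.mem_map_of_mem hmem.2))
  · intro h a
    rw [indSub_succ_eq hI hE.1 hV, indQuot_sub_eq hW hI hE hV, Submodule.map_le_iff_le_comap]
    exact fun v hv => h _ (I a).2 v hv

lemma mkQ_mem_map_mkQ_iff {k W : Type*} [Field k] [AddCommGroup W] [Module k W]
    {V E : Submodule k W} {x : W} : V.mkQ x ∈ Submodule.map V.mkQ E ↔ x ∈ E ⊔ V := by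
  rw [← Submodule.mem_comap, Submodule.comap_map_mkQ, sup_comm]

/-- Lemma `sottile`.  Let `V ∈ Ω°_I(E_•) ⊆ Gr(r,W)`.  Under the
canonical identification of `T(Gr(r,W))_V` with `Hom(V, W/V)` (computed in the chart
determined by any complement `C` of `V`), the tangent space at `V` to the Schubert
cell `Ω°_I(E_•)` equals
`{φ ∈ Hom(V, W/V) : φ(E_a(V)) ⊆ E_{i_a - a}(W/V) for a = 1, …, r}`. -/
theorem stmt8 (k : Type) [Field k] [IsAlgClosed k]
    {W : Type} [AddCommGroup W] [Module k W] [FiniteDimensional k W]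
    (n r : ℕ) (hW : Module.finrank k W = n)
    (I : Fin r → Fin n) (hI : StrictMono I)
    (E : ℕ → Submodule k W) (hE : IsFlag E)
    (V : Submodule k W) (hV : cellMem I E V)
    (C : Submodule k W) (hC : IsCompl V C) :
    (grTangent {V' : Submodule k W | cellMem I E V'} V C : Set (↥V →ₗ[k] W ⧸ V))
      = {φ : ↥V →ₗ[k] W ⧸ V | ∀ a : Fin r,
          Submodule.map φ (indSub E V ((a : ℕ) + 1)) ≤ indQuot E V ((I a : ℕ) - (a : ℕ))} := by
  ext φ
  rw [Set.mem_ofPred_eq, forall_map_indSub_le_iff hW hI hE hV, SetLike.mem_coe, grTangent,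
    Submodule.mem_map]
  constructor
  · rintro ⟨ψ, hψ, rfl⟩ u hu v hv
    refine mkQ_mem_map_mkQ_iff.mpr
      (apply_mem_sup_of_mem_mTangent hC.disjoint (fun χ hχ => ?_) hψ hv)
    exact ((hV.2 u hu).trans (hχ.2 u hu).symm).le
  · intro h
    let ψ : V →ₗ[k] C := (Submodule.quotientEquivOfIsCompl V C hC).toLinearMap ∘ₗ φ
    have hψφ : ∀ v, V.mkQ (ψ v) = φ v := fun v =>
      Submodule.mk_quotientEquivOfIsCompl_apply hC (φ v)
    refine ⟨ψ, mem_mTangent_of_forall_apply_mem hW hE hV ψ fun u hu v hv => ?_,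
      LinearMap.ext hψφ⟩
    rw [← mkQ_mem_map_mkQ_iff, hψφ]
    exact h u hu v hv

end
end

section
/- Let W be an n-dimensional vector space, V ⊆ W an r-dimensional subspace, and I a subset of [n] of cardinality r. Let A be the set of complete flags E_• on W such that V ∈ Ω°_I(E_•). Then the natural map τ: A → Fl(V) × Fl(W/V), sending a flag to the pair of induced flags on V and on W/V, is surjective. -/
noncomputable section

open Module Submodule

theorem exists_eq_of_succ_le_add_one {f : ℕ → ℕ} (h0 : f 0 = 0)
    (hf : ∀ u, f (u + 1) ≤ f u + 1) {a N : ℕ} (ha : a ≤ f N) : ∃ u, f u = a := by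
  induction N with
  | zero => exact ⟨0, by omega⟩
  | succ N ih =>
    rcases Nat.lt_or_ge (f N) a with h | h
    · exact ⟨N + 1, by have := hf N; omega⟩
    · exact ih h

/-- A complete flag is recovered from any reindexing of it which hits all its members. -/
theorem IsFlag.iInf_reindex {k M : Type*} [Field k] [AddCommGroup M] [Module k M]
    [FiniteDimensional k M] {F : ℕ → Submodule k M} (hF : IsFlag F) {f : ℕ → ℕ}
    (hf : ∀ a ≤ finrank k M, ∃ u, f u = a) {G : ℕ → Submodule k M} (hG : ∀ u, G u = F (f u))
    (a : ℕ) : ⨅ u ∈ {u : ℕ | a ≤ finrank k ↥(G u)}, G u = F a := by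
  obtain rfl : G = fun u => F (f u) := funext hG
  apply le_antisymm
  · by_cases ha : a ≤ finrank k M
    · obtain ⟨u, rfl⟩ := hf a ha
      exact iInf₂_le u (by simp [hF.2, ha])
    · have : F a = ⊤ := Submodule.eq_top_of_finrank_eq (by rw [hF.2]; omega)
      simp [this]
  · refine le_iInf₂ fun u hu => hF.1 ?_
    rw [Set.mem_ofPred_eq, hF.2] at hu
    exact hu.trans (min_le_left _ _)

/-- The number of elements of `I` among the first `u` indices. -/
def cellCount {n r : ℕ} (I : Fin r → Fin n) (u : ℕ) : ℕ :=
  (Finset.univ.filter (fun a : Fin r => (I a : ℕ) + 1 ≤ u)).card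

theorem cellCount_zero {n r : ℕ} (I : Fin r → Fin n) : cellCount I 0 = 0 := by
  simp [cellCount]

theorem cellCount_mono {n r : ℕ} (I : Fin r → Fin n) : Monotone (cellCount I) := by
  intro u v h
  refine Finset.card_le_card fun a => ?_
  simp only [Finset.mem_filter, Finset.mem_univ, true_and]
  omega

theorem cellCount_succ_le {n r : ℕ} {I : Fin r → Fin n} (hI : Function.Injective I) (u : ℕ) :
    cellCount I (u + 1) ≤ cellCount I u + 1 := by
  have h1 : (Finset.univ.filter (fun a : Fin r => (I a : ℕ) = u)).card ≤ 1 := by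
    refine Finset.card_le_one.2 fun a ha b hb => ?_
    simp only [Finset.mem_filter, Finset.mem_univ, true_and] at ha hb
    exact hI (Fin.ext (ha.trans hb.symm))
  refine le_trans (Finset.card_le_card fun a => ?_)
    ((Finset.card_union_le _ _).trans (Nat.add_le_add_left h1 _))
  simp only [Finset.mem_union, Finset.mem_filter, Finset.mem_univ, true_and]
  omega

theorem cellCount_le {n r : ℕ} {I : Fin r → Fin n} (hI : Function.Injective I) (u : ℕ) :
    cellCount I u ≤ u := by
  induction u with
  | zero => simp [cellCount_zero]
  | succ u ih => exact (cellCount_succ_le hI u).trans (by omega)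

theorem cellCount_of_le {n r : ℕ} (I : Fin r → Fin n) {u : ℕ} (hu : n ≤ u) :
    cellCount I u = r := by
  rw [cellCount, Finset.filter_true_of_mem fun a _ => by have := (I a).2; omega]
  simp

theorem monotone_sub_cellCount {n r : ℕ} {I : Fin r → Fin n} (hI : Function.Injective I) :
    Monotone (fun u => u - cellCount I u) :=
  monotone_nat_of_le_succ fun u => by have := cellCount_succ_le hI u; omega

section GluedSubspace

variable {k W : Type*} [Field k] [AddCommGroup W] [Module k W] {V : Submodule k W}

/-- The subspace of `W` glued from subspaces of `V` and of `W ⧸ V` along a section `s` of the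
projection `W → W ⧸ V`. -/
def glue (s : (W ⧸ V) →ₗ[k] W) (A : Submodule k V) (B : Submodule k (W ⧸ V)) :
    Submodule k W :=
  A.map V.subtype ⊔ B.map s

theorem comap_subtype_glue {s : (W ⧸ V) →ₗ[k] W} (hs : ∀ x, V.mkQ (s x) = x)
    (A : Submodule k V) (B : Submodule k (W ⧸ V)) :
    (glue s A B).comap V.subtype = A := by
  ext x
  simp only [glue, Submodule.mem_comap, Submodule.mem_sup, Submodule.mem_map]
  constructor
  · rintro ⟨_, ⟨a, ha, rfl⟩, _, ⟨b, hb, rfl⟩, h⟩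
    have hb0 : b = 0 := by
      have hsb : s b = ↑(x - a) := by
        rw [V.coe_sub]
        exact eq_sub_of_add_eq' h
      rw [← hs b, hsb]
      exact (Submodule.Quotient.mk_eq_zero V).2 (x - a).2
    subst hb0
    have : a = x := Subtype.ext (by simpa using h)
    exact this ▸ ha
  · intro hx
    exact ⟨x, ⟨x, hx, rfl⟩, 0, ⟨0, B.zero_mem, map_zero s⟩, by simp⟩

theorem map_mkQ_glue {s : (W ⧸ V) →ₗ[k] W} (hs : ∀ x, V.mkQ (s x) = x)
    (A : Submodule k V) (B : Submodule k (W ⧸ V)) :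
    (glue s A B).map V.mkQ = B := by
  have h1 : V.mkQ ∘ₗ V.subtype = 0 := by ext x; simp
  have h2 : V.mkQ ∘ₗ s = LinearMap.id := LinearMap.ext hs
  rw [glue, Submodule.map_sup, ← Submodule.map_comp, ← Submodule.map_comp, h1, h2]
  simp

theorem finrank_glue [FiniteDimensional k W] {s : (W ⧸ V) →ₗ[k] W} (hs : ∀ x, V.mkQ (s x) = x)
    (A : Submodule k V) (B : Submodule k (W ⧸ V)) :
    finrank k ↥(glue s A B) = finrank k A + finrank k B := by
  have hinj : Function.Injective s := Function.LeftInverse.injective hs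
  have hdisj : A.map V.subtype ⊓ B.map s = ⊥ := by
    rw [Submodule.eq_bot_iff]
    rintro _ ⟨⟨a, -, rfl⟩, ⟨b, -, hb⟩⟩
    have hb0 : b = 0 := by
      rw [← hs b, hb]
      simp
    rw [← hb, hb0, map_zero]
  have := Submodule.finrank_sup_add_finrank_inf_eq (A.map V.subtype) (B.map s)
  rw [hdisj, finrank_bot, add_zero] at this
  rw [glue, this, (A.equivMapOfInjective _ V.injective_subtype).finrank_eq,
    (B.equivMapOfInjective _ hinj).finrank_eq]

end GluedSubspace

theorem finrank_inf_eq_finrank_comap {k W : Type*} [Field k] [AddCommGroup W] [Module k W]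
    (V E : Submodule k W) : finrank k ↥(V ⊓ E) = finrank k ↥(E.comap V.subtype) := by
  rw [← Submodule.map_comap_subtype]
  exact ((E.comap V.subtype).equivMapOfInjective _ V.injective_subtype).finrank_eq.symm

/-- Lemma `flags`.  For `V ⊆ W` of dimension `r` and `I ⊆ [n]` of
cardinality `r`, the map sending a complete flag `E_•` on `W` with `V ∈ Ω°_I(E_•)` to
the pair of induced complete flags on `V` and on `W/V` is surjective. -/
theorem stmt11 (k : Type) [Field k] [IsAlgClosed k]
    {W : Type} [AddCommGroup W] [Module k W] [FiniteDimensional k W]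
    (n r : ℕ) (hW : Module.finrank k W = n)
    (V : Submodule k W) (hVr : Module.finrank k ↥V = r)
    (I : Fin r → Fin n) (hI : StrictMono I)
    (FV : ℕ → Submodule k ↥V) (hFV : IsFlag FV)
    (FQ : ℕ → Submodule k (W ⧸ V)) (hFQ : IsFlag FQ) :
    ∃ E : ℕ → Submodule k W, IsFlag E ∧ cellMem I E V ∧
      (∀ a : ℕ, indSub E V a = FV a) ∧ (∀ b : ℕ, indQuot E V b = FQ b) := by
  have hinj := hI.injective
  have hr : r ≤ n := by rw [← hW, ← hVr]; exact V.finrank_le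
  have hQ : finrank k (W ⧸ V) = n - r := by
    have := V.finrank_quotient_add_finrank
    omega
  obtain ⟨s, hs⟩ := V.mkQ.exists_rightInverse_of_surjective V.range_mkQ
  replace hs : ∀ x, V.mkQ (s x) = x := fun x => LinearMap.congr_fun hs x
  have hlast : cellCount I n = r := cellCount_of_le I le_rfl
  have hle : ∀ u, cellCount I u ≤ r := fun u =>
    (cellCount_mono I (le_max_left u n)).trans (cellCount_of_le I (le_max_right u n)).le
  refine ⟨fun u => glue s (FV (cellCount I u)) (FQ (u - cellCount I u)), ⟨?_, ?_⟩, ⟨hVr, ?_⟩,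
    ?_, ?_⟩
  · intro u v h
    exact sup_le_sup (Submodule.map_mono (hFV.1 (cellCount_mono I h)))
      (Submodule.map_mono (hFQ.1 (monotone_sub_cellCount hinj h)))
  · intro u
    rw [finrank_glue hs, hFV.2, hFQ.2, hVr, hQ, hW]
    have h1 := hle u
    have h2 := cellCount_le hinj u
    rcases le_total u n with h | h
    · have h3 : u - cellCount I u ≤ n - cellCount I n := monotone_sub_cellCount hinj h
      omega
    · have h3 := cellCount_of_le I h
      omega
  · intro u _
    rw [finrank_inf_eq_finrank_comap, comap_subtype_glue hs, hFV.2, hVr, min_eq_left (hle u),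
      cellCount]
  · intro a
    refine hFV.iInf_reindex (f := cellCount I) (fun b hb => ?_)
      (fun u => comap_subtype_glue hs _ _) a
    exact exists_eq_of_succ_le_add_one (cellCount_zero I) (cellCount_succ_le hinj)
      (N := n) (by omega)
  · intro b
    refine hFQ.iInf_reindex (f := fun u => u - cellCount I u) (fun a ha => ?_)
      (fun u => map_mkQ_glue hs _ _) b
    exact exists_eq_of_succ_le_add_one (f := fun u => u - cellCount I u) (by simp)
      (fun u => by have := cellCount_mono I (Nat.le_add_right u 1); omega) (N := n)
      (by omega)

end
end
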